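/- arXiv:0909.4561 — 3 statements merged into one kernel-verified Lean document; each statement's English description precedes it below -/
import Mathlib

section
/- (Kolmogorov Superposition Theorem) For each fixed integer n ≥ 2 there exist n(2n+1) continuous functions ψ^{pq} : [0,1] → ℝ (for p = 1,…,n and q = 1,…,2n+1) such that every continuous function f : [0,1]^n → ℝ can be written as f(x_1,…,x_n) = Σ_{q=1}^{2n+1} g_q(φ^q(x_1,…,x_n)), where φ^q(x_1,…,x_n) = Σ_{p=1}^{n} ψ^{pq}(x_p), for some continuous functions g_1,…,g_{2n+1} : ℝ → ℝ depending on f. -/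
namespace KST

/-- Continuous perturbation of `ψ₀` prescribed on a closed set. -/
lemma perturb {X : Type*} [TopologicalSpace X] [CompactSpace X] [T2Space X] (ψ₀ : C(X, ℝ)) (K : Set X) (hK : IsClosed K)
    (w : X → ℝ) (hw : ContinuousOn w K) (ε : ℝ) (hε : 0 ≤ ε) (h : ∀ x ∈ K, |w x - ψ₀ x| ≤ ε) :
    ∃ ψ : C(X, ℝ), ‖ψ - ψ₀‖ ≤ ε ∧ ∀ x ∈ K, ψ x = w x := by
  have : CompactSpace K := isCompact_iff_compactSpace.mp hK.isCompact
  let d : C(K, ℝ) := ⟨fun x => w x - ψ₀ x, by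
    have := hw.domRestrict
    exact this.sub (ψ₀.continuous.comp continuous_subtype_val)⟩
  let db : BoundedContinuousFunction K ℝ := BoundedContinuousFunction.mkOfCompact d
  have hdb : ‖db‖ ≤ ε := by
    rw [BoundedContinuousFunction.norm_le hε]
    intro x
    exact h x x.2
  obtain ⟨g, hg, hge⟩ := BoundedContinuousFunction.exists_extension_norm_eq_of_isClosedEmbedding
    db hK.isClosedEmbedding_subtypeVal
  refine ⟨ψ₀ + g.toContinuousMap, ?_, ?_⟩
  · rw [add_sub_cancel_left, ContinuousMap.norm_le _ hε]
    intro x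
    exact (g.norm_coe_le_norm x).trans (hg.trans_le hdb)
  · intro x hx
    have := congrFun hge ⟨x, hx⟩
    have h2 : g x = w x - ψ₀ x := this
    simp [h2]

/-- The values assigned to the cells. -/
noncomputable def val (n M : ℕ) (η : ℝ) (a : ℝ) (p j : ℕ) : ℝ :=
  η * (⌊a / η⌋ + ((j * M ^ p : ℕ) : ℝ) / ((M ^ n : ℕ) : ℝ))

lemma val_close (n M : ℕ) (η : ℝ) (hη : 0 < η) (a : ℝ) (p j : ℕ) (hp : p < n) (hj : j < M) :
    |val n M η a p j - a| ≤ η := by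
  have h1 : ((j * M ^ p : ℕ) : ℝ) / ((M ^ n : ℕ) : ℝ) ≤ 1 := by
    apply div_le_one_of_le₀ _ (by positivity)
    have : j * M ^ p ≤ M ^ n := calc
      j * M ^ p ≤ M * M ^ p := by gcongr
      _ = M ^ (p + 1) := by ring
      _ ≤ M ^ n := Nat.pow_le_pow_right (by omega) (by omega)
    exact_mod_cast this
  have h0 : 0 ≤ ((j * M ^ p : ℕ) : ℝ) / ((M ^ n : ℕ) : ℝ) := by positivity
  set b := ((j * M ^ p : ℕ) : ℝ) / ((M ^ n : ℕ) : ℝ)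
  have h2 := Int.floor_le (a / η)
  have h3 := Int.lt_floor_add_one (a / η)
  have h4 : val n M η a p j - a = η * (⌊a / η⌋ + b - a / η) := by
    have : val n M η a p j = η * (⌊a / η⌋ + b) := rfl
    rw [this]; field_simp
  rw [h4, abs_mul, abs_of_pos hη]
  have : |(⌊a / η⌋ + b - a / η : ℝ)| ≤ 1 := by
    rw [abs_le]; constructor <;> linarith
  nlinarith

lemma val_inj (n M : ℕ) (η : ℝ) (hη : 0 < η) (a : Fin n → ℕ → ℝ) :
    Function.Injective (fun j : Fin n → Fin M => ∑ p, val n M η (a p (j p)) p (j p)) := by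
  intro j k h
  have key : ∀ j : Fin n → Fin M, ∑ p, val n M η (a p (j p)) p (j p) =
      η * (((∑ p, ⌊a p (j p) / η⌋ : ℤ) : ℝ) + ((finFunctionFinEquiv j : ℕ) : ℝ) / ((M ^ n : ℕ) : ℝ)) := by
    intro j
    unfold val
    rw [← Finset.mul_sum, Finset.sum_add_distrib, finFunctionFinEquiv_apply, ← Finset.sum_div]
    push_cast
    rfl
  simp only [key] at h
  have h := mul_left_cancel₀ hη.ne' h
  have hj := (finFunctionFinEquiv j).2
  have hk := (finFunctionFinEquiv k).2
  have hM : (0 : ℝ) < ((M ^ n : ℕ) : ℝ) := by exact_mod_cast (by omega : 0 < M ^ n)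
  apply finFunctionFinEquiv.injective
  apply Fin.ext
  clear key
  generalize (finFunctionFinEquiv j : ℕ) = B at *
  generalize (finFunctionFinEquiv k : ℕ) = C at *
  generalize (∑ p, ⌊a p (j p) / η⌋ : ℤ) = A at *
  generalize (∑ p, ⌊a p (k p) / η⌋ : ℤ) = D at *
  generalize M ^ n = L at *
  have h5 : (A : ℝ) * L + B = D * L + C := by
    field_simp at h; linarith
  have h6 : A * L + B = D * L + C := by exact_mod_cast h5
  have h7 : ((A * L + B : ℤ)) % L = (D * L + C) % L := by rw [h6]
  rw [add_comm, Int.add_mul_emod_self_right, add_comm, Int.add_mul_emod_self_right,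
    Int.emod_eq_of_lt (by omega) (by omega), Int.emod_eq_of_lt (by omega) (by omega)] at h7
  exact_mod_cast h7

abbrev I := Set.Icc (0 : ℝ) 1

noncomputable def tt (N m : ℕ) (q : Fin m) (x : I) : ℝ := N * (x : ℝ) + (q : ℕ) / (m : ℝ)

lemma tt_cont (N m : ℕ) (q : Fin m) : Continuous (tt N m q) := by unfold tt; fun_prop

def KK (N m : ℕ) (q : Fin m) : Set I := {x | 1 / (2 * (m : ℝ)) ≤ ‖((tt N m q x : ℝ) : UnitAddCircle)‖}

noncomputable def cell (N m : ℕ) (q : Fin m) (x : I) : ℕ := ⌊tt N m q x⌋₊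

lemma KK_closed (N m : ℕ) (q : Fin m) : IsClosed (KK N m q) := by
  refine isClosed_le continuous_const ?_
  exact continuous_norm.comp ((AddCircle.continuous_mk' 1).comp (tt_cont N m q))

lemma tt_nonneg (N m : ℕ) (q : Fin m) (x : I) : 0 ≤ tt N m q x := by
  have := x.2.1
  unfold tt; positivity

lemma q_div (m : ℕ) (q : Fin m) : (0:ℝ) ≤ (q : ℕ) / (m : ℝ) ∧ ((q : ℕ) / (m : ℝ) : ℝ) < 1 := by
  have : ((q : ℕ) : ℝ) < m := by exact_mod_cast q.2
  constructor
  · positivity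
  · rw [div_lt_one (by linarith [(q : ℕ).cast_nonneg (α := ℝ)])]; exact this

lemma cell_lt (N m : ℕ) (q : Fin m) (x : I) : cell N m q x < N + 1 := by
  unfold cell
  rw [Nat.floor_lt (tt_nonneg N m q x)]
  have h1 := x.2.2
  have h2 := q_div m q
  unfold tt
  push_cast
  nlinarith [(N.cast_nonneg : (0:ℝ) ≤ N)]

lemma cell_close (N m : ℕ) (hN : 0 < N) (q : Fin m) (x : I) :
    dist x (Set.projIcc (0:ℝ) 1 zero_le_one ((cell N m q x : ℝ) / N)) ≤ 1 / N := by
  have hN' : (0:ℝ) < N := by exact_mod_cast hN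
  have e : x = Set.projIcc (0:ℝ) 1 zero_le_one (x:ℝ) := (Set.projIcc_val zero_le_one x).symm
  have h1 := Nat.floor_le (tt_nonneg N m q x)
  have h2 := Nat.lt_floor_add_one (tt N m q x)
  have h3 := q_div m q
  have h4 : |(x:ℝ) - (cell N m q x : ℝ) / N| ≤ 1 / N := by
    have : (x:ℝ) - (cell N m q x : ℝ) / N = (N * x - cell N m q x) / N := by field_simp
    rw [this, abs_div, abs_of_pos hN']
    gcongr
    unfold cell
    unfold tt at *
    rw [abs_le]; constructor <;> linarith
  conv_lhs => arg 1; rw [e]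
  refine le_trans ?_ h4
  have := (LipschitzWith.projIcc (zero_le_one (α := ℝ))).dist_le_mul (x:ℝ) ((cell N m q x : ℝ) / N)
  simpa [Real.dist_eq] using this

lemma cell_cont (N m : ℕ) (q : Fin m) : ContinuousOn (cell N m q) (KK N m q) := by
  intro x hx
  apply ContinuousAt.continuousWithinAt
  have hm : (0:ℝ) < m := by exact_mod_cast (Nat.zero_le _).trans_lt q.2
  have hne : tt N m q x ≠ cell N m q x := by
    intro h
    have hx' : 1 / (2 * (m : ℝ)) ≤ ‖((tt N m q x : ℝ) : UnitAddCircle)‖ := hx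
    rw [UnitAddCircle.norm_eq, h] at hx'
    simp only [round_natCast, Int.cast_natCast, sub_self, abs_zero] at hx'
    have : 0 < 1 / (2 * (m : ℝ)) := by positivity
    linarith
  have h1 := lt_of_le_of_ne (Nat.floor_le (tt_nonneg N m q x)) (Ne.symm hne)
  have h2 := Nat.lt_floor_add_one (tt N m q x)
  have hc := (tt_cont N m q).continuousAt (x := x)
  have ev := hc.eventually (Ioo_mem_nhds h1 h2)
  apply (continuousAt_const (y := cell N m q x)).congr
  filter_upwards [ev] with y hy
  symm
  unfold cell
  rw [Nat.floor_eq_iff (tt_nonneg N m q y)]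
  exact ⟨hy.1.le, hy.2⟩

lemma bad_unique (N m : ℕ) (q q' : Fin m) (x : I) (h : x ∉ KK N m q) (h' : x ∉ KK N m q') :
    q = q' := by
  have hm : (0:ℝ) < m := by exact_mod_cast (Nat.zero_le _).trans_lt q.2
  simp only [KK, Set.mem_ofPred_eq, not_le, UnitAddCircle.norm_eq] at h h'
  set r := round (tt N m q x)
  set r' := round (tt N m q' x)
  rw [abs_lt] at h h'
  unfold tt at h h'
  have e1 : (q : ℕ) / (m : ℝ) - r - ((q' : ℕ) / (m : ℝ) - r') < 1 / m := by
    have : 1 / (m:ℝ) = 1 / (2 * (m : ℝ)) + 1 / (2 * (m : ℝ)) := by field_simp; norm_num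
    linarith
  have e2 : (q' : ℕ) / (m : ℝ) - r' - ((q : ℕ) / (m : ℝ) - r) < 1 / m := by
    have : 1 / (m:ℝ) = 1 / (2 * (m : ℝ)) + 1 / (2 * (m : ℝ)) := by field_simp; norm_num
    linarith
  have f1 : ((q : ℕ) : ℝ) - q' - m * (r - r') < 1 := by
    have := mul_lt_mul_of_pos_left e1 hm
    field_simp at this; linarith
  have f2 : -1 < ((q : ℕ) : ℝ) - q' - m * (r - r') := by
    have := mul_lt_mul_of_pos_left e2 hm
    field_simp at this; linarith
  have g1 : ((q : ℕ) : ℤ) - q' - m * (r - r') < 1 := by exact_mod_cast f1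
  have g2 : -1 < ((q : ℕ) : ℤ) - q' - m * (r - r') := by exact_mod_cast f2
  have g3 : ((q : ℕ) : ℤ) - q' = m * (r - r') := by omega
  have := q.2
  have := q'.2
  have g4 : ((q : ℕ) : ℤ) - q' = 0 :=
    Int.eq_zero_of_abs_lt_dvd (m := (m:ℤ)) ⟨_, g3⟩ (by rw [abs_lt]; constructor <;> omega)
  exact Fin.ext (by omega)

/-- The inner sums `φ^q`. -/
noncomputable def Phi {n m : ℕ} (ψ : Fin n → Fin m → C(I, ℝ)) (q : Fin m) : C(Fin n → I, ℝ) :=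
  ∑ p, (ψ p q).comp ⟨fun x => x p, continuous_apply p⟩

lemma Phi_apply {n m : ℕ} (ψ : Fin n → Fin m → C(I, ℝ)) (q : Fin m) (x : Fin n → I) :
    Phi ψ q x = ∑ p, ψ p q (x p) := by
  simp [Phi]

lemma Phi_cont {n m : ℕ} (q : Fin m) :
    Continuous (fun ψ : Fin n → Fin m → C(I, ℝ) => Phi ψ q) := by
  unfold Phi
  refine continuous_finsetSum _ fun p _ => ?_
  refine (ContinuousMap.continuous_precomp _).comp ?_
  fun_prop

/-- The superposition. -/
noncomputable def T {n m : ℕ} (ψ : Fin n → Fin m → C(I, ℝ))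
    (g : Fin m → BoundedContinuousFunction ℝ ℝ) : C(Fin n → I, ℝ) :=
  ∑ q, (g q).toContinuousMap.comp (Phi ψ q)

lemma T_apply {n m : ℕ} (ψ : Fin n → Fin m → C(I, ℝ))
    (g : Fin m → BoundedContinuousFunction ℝ ℝ) (x : Fin n → I) :
    T ψ g x = ∑ q, g q (∑ p, ψ p q (x p)) := by
  simp [T, Phi_apply]

lemma T_cont {n m : ℕ} (g : Fin m → BoundedContinuousFunction ℝ ℝ) :
    Continuous (fun ψ : Fin n → Fin m → C(I, ℝ) => T ψ g) := by
  unfold T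
  refine continuous_finsetSum _ fun q _ => ?_
  exact (ContinuousMap.continuous_postcomp _).comp (Phi_cont q)

lemma good_card (n N : ℕ) (x : Fin n → I) :
    ∃ S : Finset (Fin (2 * n + 1)), S.card = n + 1 ∧ ∀ q ∈ S, ∀ p, x p ∈ KK N (2 * n + 1) q := by
  classical
  let B : Finset (Fin (2 * n + 1)) := Finset.univ.filter fun q => ∃ p, x p ∉ KK N (2 * n + 1) q
  have hB : B.card ≤ n := by
    have h1 : ∀ q : B, ∃ p, x p ∉ KK N (2 * n + 1) q := fun q => (Finset.mem_filter.mp q.2).2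
    choose c hc using h1
    have inj : Function.Injective c := by
      intro q q' h
      apply Subtype.ext
      refine bad_unique N _ _ _ (x (c q)) (hc q) ?_
      rw [h]; exact hc q'
    have := Fintype.card_le_of_injective c inj
    simpa using this
  have hBc : n + 1 ≤ Bᶜ.card := by
    rw [Finset.card_compl, Fintype.card_fin]; omega
  obtain ⟨S, hS, hc⟩ := Finset.exists_subset_card_eq hBc
  refine ⟨S, hc, fun q hq p => ?_⟩
  have := hS hq
  by_contra hcon
  rw [Finset.mem_compl] at this
  exact this (Finset.mem_filter.mpr ⟨Finset.mem_univ _, p, hcon⟩)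

lemma density (n : ℕ) (f : C(Fin n → I, ℝ)) (hf : f ≠ 0)
    (ψ₀ : Fin n → Fin (2 * n + 1) → C(I, ℝ)) (ε : ℝ) (hε : 0 < ε) :
    ∃ ψ : Fin n → Fin (2 * n + 1) → C(I, ℝ), dist ψ ψ₀ ≤ ε ∧
      ∃ g : Fin (2 * n + 1) → BoundedContinuousFunction ℝ ℝ,
        (∀ q, ‖g q‖ ≤ ‖f‖) ∧ ‖f - T ψ g‖ < (1 - 1 / (4 * ((n : ℝ) + 1))) * ‖f‖ := by
  have hfp : 0 < ‖f‖ := norm_pos_iff.mpr hf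
  have hn1 : (0:ℝ) < (n : ℝ) + 1 := by positivity
  set δ : ℝ := ‖f‖ / (2 * ((n:ℝ) + 1)) with hδ
  have hδp : 0 < δ := by positivity
  -- uniform continuity
  have huf : UniformContinuous f := CompactSpace.uniformContinuous_of_continuous f.continuous
  obtain ⟨d₁, hd₁, hf1⟩ := Metric.uniformContinuous_iff.mp huf δ hδp
  have huψ : ∀ p q, ∃ d > 0, ∀ {a b : I}, dist a b < d → dist (ψ₀ p q a) (ψ₀ p q b) < ε / 2 :=
    fun p q => Metric.uniformContinuous_iff.mp
      (CompactSpace.uniformContinuous_of_continuous (ψ₀ p q).continuous) (ε / 2) (by positivity)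
  choose d₂ hd₂ hψ using huψ
  have hsmall : ∃ d > 0, d ≤ d₁ ∧ ∀ p q, d ≤ d₂ p q := by
    have : ∀ᶠ d in nhdsWithin (0:ℝ) (Set.Ioi 0), d ≤ d₁ ∧ ∀ p q, d ≤ d₂ p q := by
      refine Filter.Eventually.and ?_ (Filter.eventually_all.mpr fun p =>
        Filter.eventually_all.mpr fun q => ?_)
      · exact nhdsWithin_le_nhds (Iic_mem_nhds hd₁)
      · exact nhdsWithin_le_nhds (Iic_mem_nhds (hd₂ p q))
    obtain ⟨d, h1, h2⟩ := (this.and self_mem_nhdsWithin).exists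
    exact ⟨d, h2, h1⟩
  obtain ⟨d, hd, hdd₁, hdd₂⟩ := hsmall
  obtain ⟨N', hN'⟩ := exists_nat_one_div_lt hd
  set N := N' + 1 with hNdef
  have hN : 0 < N := by omega
  have hNd : 1 / (N : ℝ) < d := by rw [hNdef]; push_cast; exact hN'
  let P : ℕ → I := fun j => Set.projIcc (0:ℝ) 1 zero_le_one ((j : ℝ) / N)
  have hP : ∀ (q : Fin (2 * n + 1)) (x : I), dist x (P (cell N _ q x)) < d :=
    fun q x => (cell_close N _ hN q x).trans_lt hNd
  let V : Fin n → Fin (2 * n + 1) → ℕ → ℝ := fun p q j =>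
    val n (N + 1) (ε / 2) (ψ₀ p q (P j)) p j
  have hpert : ∀ p q, ∃ ψ : C(I, ℝ), ‖ψ - ψ₀ p q‖ ≤ ε ∧
      ∀ x ∈ KK N _ q, ψ x = V p q (cell N _ q x) := by
    intro p q
    refine perturb (ψ₀ p q) _ (KK_closed N _ q) (fun x => V p q (cell N _ q x))
      ((continuous_of_discreteTopology (f := V p q)).comp_continuousOn (cell_cont N _ q)) ε hε.le ?_
    intro x hx
    have h1 := val_close n (N + 1) (ε / 2) (by positivity) (ψ₀ p q (P (cell N _ q x))) p
      (cell N _ q x) p.2 (cell_lt N _ q x)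
    have h2 := hψ p q ((hP q x).trans_le (hdd₂ p q))
    rw [dist_comm, Real.dist_eq] at h2
    calc |V p q (cell N _ q x) - ψ₀ p q x|
        = |(V p q (cell N _ q x) - ψ₀ p q (P (cell N _ q x))) +
            (ψ₀ p q (P (cell N _ q x)) - ψ₀ p q x)| := by ring_nf
      _ ≤ _ := abs_add_le _ _
      _ ≤ ε / 2 + ε / 2 := add_le_add h1 h2.le
      _ = ε := by ring
  choose ψ hψ1 hψ2 using hpert
  have hg : ∀ q, ∃ g : BoundedContinuousFunction ℝ ℝ, ‖g‖ ≤ ‖f‖ / (n + 1) ∧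
      ∀ j : Fin n → Fin (N + 1), g (∑ p, V p q (j p)) = f (fun p => P (j p)) / (n + 1) := by
    intro q
    let e : (Fin n → Fin (N + 1)) → ℝ := fun j => ∑ p, V p q (j p)
    have he : Topology.IsClosedEmbedding e := by
      refine Continuous.isClosedEmbedding continuous_of_discreteTopology ?_
      exact val_inj n (N + 1) (ε / 2) (by positivity) (fun p j => ψ₀ p q (P j))
    let h : BoundedContinuousFunction (Fin n → Fin (N + 1)) ℝ :=
      BoundedContinuousFunction.mkOfCompact
        ⟨fun j => f (fun p => P (j p)) / (n + 1), continuous_of_discreteTopology⟩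
    obtain ⟨g, hg, hge⟩ :=
      BoundedContinuousFunction.exists_extension_norm_eq_of_isClosedEmbedding h he
    refine ⟨g, ?_, fun j => congrFun hge j⟩
    rw [hg, BoundedContinuousFunction.norm_le (by positivity)]
    intro j
    change ‖f (fun p => P (j p)) / (n + 1)‖ ≤ _
    rw [norm_div, Real.norm_of_nonneg hn1.le]
    gcongr
    exact f.norm_coe_le_norm _
  choose g hg1 hg2 using hg
  refine ⟨ψ, ?_, g, ?_, ?_⟩
  · rw [dist_pi_le_iff hε.le]
    intro p
    rw [dist_pi_le_iff hε.le]
    intro q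
    rw [dist_eq_norm]
    exact hψ1 p q
  · intro q
    refine (hg1 q).trans (div_le_self hfp.le ?_)
    linarith [(n.cast_nonneg : (0:ℝ) ≤ n)]
  · have hfin : δ + n * (‖f‖ / (n + 1)) < (1 - 1 / (4 * ((n : ℝ) + 1))) * ‖f‖ := by
      rw [hδ]
      have : (1 - 1 / (4 * ((n : ℝ) + 1))) * ‖f‖ - (‖f‖ / (2 * ((n:ℝ) + 1)) + n * (‖f‖ / (n + 1)))
        = ‖f‖ / (4 * ((n : ℝ) + 1)) := by field_simp; ring
      have : 0 < ‖f‖ / (4 * ((n : ℝ) + 1)) := by positivity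
      linarith
    refine lt_of_le_of_lt ?_ hfin
    rw [ContinuousMap.norm_le _ (by positivity)]
    intro x
    obtain ⟨S, hS, hSx⟩ := good_card n N x
    have hgood : ∀ q ∈ S, |f x / (n + 1) - g q (∑ p, ψ p q (x p))| ≤ δ / (n + 1) := by
      intro q hq
      have h1 : ∑ p, ψ p q (x p) = ∑ p, V p q (cell N _ q (x p)) :=
        Finset.sum_congr rfl fun p _ => hψ2 p q _ (hSx q hq p)
      have h2 := hg2 q (fun p => ⟨cell N _ q (x p), cell_lt N _ q (x p)⟩)
      simp only at h2
      rw [h1, h2, ← sub_div, abs_div, abs_of_pos hn1]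
      gcongr
      rw [← Real.dist_eq]
      refine (hf1 ?_).le
      rw [dist_pi_lt_iff hd₁]
      intro p
      exact (hP q (x p)).trans_le hdd₁
    have hbad : ∀ q ∈ Sᶜ, |g q (∑ p, ψ p q (x p))| ≤ ‖f‖ / (n + 1) := fun q _ =>
      ((g q).norm_coe_le_norm _).trans (hg1 q)
    have hSc : Sᶜ.card = n := by
      rw [Finset.card_compl, Fintype.card_fin, hS]; omega
    have hsplit : (f - T ψ g) x = ∑ q ∈ S, (f x / (n + 1) - g q (∑ p, ψ p q (x p)))
        - ∑ q ∈ Sᶜ, g q (∑ p, ψ p q (x p)) := by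
      rw [ContinuousMap.sub_apply, T_apply, Finset.sum_sub_distrib, Finset.sum_const, hS,
        ← Finset.sum_add_sum_compl S]
      have : (n + 1) • (f x / ((n:ℝ) + 1)) = f x := by
        rw [nsmul_eq_mul]; push_cast; field_simp
      rw [this]; ring
    rw [hsplit]
    refine (norm_sub_le _ _).trans (add_le_add ?_ ?_)
    · refine (norm_sum_le_of_le _ hgood).trans ?_
      rw [Finset.sum_const, hS, nsmul_eq_mul]; push_cast
      apply le_of_eq; field_simp
    · refine (norm_sum_le_of_le _ hbad).trans ?_
      rw [Finset.sum_const, hSc, nsmul_eq_mul]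

lemma exists_good (n : ℕ) : ∃ ψ : Fin n → Fin (2 * n + 1) → C(I, ℝ),
    ∀ f : C(Fin n → I, ℝ), ∃ g : Fin (2 * n + 1) → BoundedContinuousFunction ℝ ℝ,
      ‖g‖ ≤ 2 * ‖f‖ ∧ ‖f - T ψ g‖ ≤ (1 - 1 / (12 * ((n : ℝ) + 1))) * ‖f‖ := by
  set θ : ℝ := 1 - 1 / (4 * ((n : ℝ) + 1)) with hθ
  let U : C(Fin n → I, ℝ) → Set (Fin n → Fin (2 * n + 1) → C(I, ℝ)) := fun f =>
    ⋃ g ∈ {g : Fin (2 * n + 1) → BoundedContinuousFunction ℝ ℝ | ∀ q, ‖g q‖ ≤ ‖f‖},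
      {ψ | f ≠ 0 → ‖f - T ψ g‖ < θ * ‖f‖}
  have hopen : ∀ f, IsOpen (U f) := by
    intro f
    refine isOpen_biUnion fun g _ => ?_
    by_cases hf : f = 0
    · simp [hf]
    · simp only [ne_eq, hf, not_false_eq_true, forall_const]
      exact isOpen_lt (continuous_norm.comp (continuous_const.sub (T_cont g))) continuous_const
  have hdense : ∀ f, Dense (U f) := by
    intro f
    by_cases hf : f = 0
    · have : U f = Set.univ := by
        apply Set.eq_univ_of_forall
        intro ψ
        simp only [U, Set.mem_iUnion]
        exact ⟨0, by simp, fun h => absurd hf h⟩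
      rw [this]; exact dense_univ
    · rw [Metric.dense_iff]
      intro ψ₀ r hr
      obtain ⟨ψ, h1, g, h2, h3⟩ := density n f hf ψ₀ (r / 2) (by positivity)
      refine ⟨ψ, ?_, ?_⟩
      · rw [Metric.mem_ball]; linarith
      · simp only [U, Set.mem_iUnion]
        exact ⟨g, h2, fun _ => h3⟩
  let D := TopologicalSpace.denseSeq C(Fin n → I, ℝ)
  have hD : DenseRange D := TopologicalSpace.denseRange_denseSeq _
  have : BaireSpace (Fin n → Fin (2 * n + 1) → C(I, ℝ)) :=
    BaireSpace.of_completelyPseudoMetrizable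
  obtain ⟨ψ, hψ⟩ := (dense_iInter_of_isOpen (fun k => hopen (D k)) (fun k => hdense (D k))).nonempty
  rw [Set.mem_iInter] at hψ
  refine ⟨ψ, fun f => ?_⟩
  by_cases hf : f = 0
  · refine ⟨0, by simp, ?_⟩
    have : T ψ (0 : Fin (2 * n + 1) → BoundedContinuousFunction ℝ ℝ) = 0 := by
      ext x; simp [T_apply]
    simp [hf, this]
  have hfp : 0 < ‖f‖ := norm_pos_iff.mpr hf
  set κ : ℝ := 1 / (12 * ((n : ℝ) + 1)) with hκ
  have hκp : 0 < κ := by positivity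
  have hθκ : θ = 1 - 3 * κ := by rw [hθ, hκ]; field_simp; ring
  have hκ1 : κ ≤ 1 / 12 := by
    rw [hκ]; apply one_div_le_one_div_of_le (by norm_num)
    linarith [(n.cast_nonneg : (0:ℝ) ≤ n)]
  obtain ⟨k, hk⟩ := hD.exists_dist_lt f (ε := κ * ‖f‖) (by positivity)
  rw [dist_eq_norm] at hk
  have hk1 : ‖D k‖ ≤ (1 + κ) * ‖f‖ := by
    have := norm_sub_le f (f - D k)
    rw [sub_sub_cancel] at this
    linarith
  have hk0 : D k ≠ 0 := by
    intro h
    rw [h, sub_zero] at hk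
    nlinarith
  have := hψ k
  simp only [U, Set.mem_iUnion] at this
  obtain ⟨g, hg, hgψ⟩ := this
  refine ⟨g, ?_, ?_⟩
  · rw [pi_norm_le_iff_of_nonneg (by positivity)]
    intro q
    refine (hg q).trans (hk1.trans ?_)
    gcongr; linarith
  · have h1 : ‖D k - T ψ g‖ < θ * ‖D k‖ := hgψ hk0
    have h2 : ‖f - T ψ g‖ ≤ ‖f - D k‖ + ‖D k - T ψ g‖ := norm_sub_le_norm_sub_add_norm_sub _ _ _
    have h3 : θ * ‖D k‖ ≤ θ * ((1 + κ) * ‖f‖) := by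
      apply mul_le_mul_of_nonneg_left hk1; rw [hθκ]; linarith
    rw [hθκ] at *
    nlinarith [mul_pos hκp hfp]

lemma iterate (n : ℕ) (ψ : Fin n → Fin (2 * n + 1) → C(I, ℝ)) (θ : ℝ) (h0 : 0 ≤ θ) (h1 : θ < 1)
    (H : ∀ f : C(Fin n → I, ℝ), ∃ g : Fin (2 * n + 1) → BoundedContinuousFunction ℝ ℝ,
      ‖g‖ ≤ 2 * ‖f‖ ∧ ‖f - T ψ g‖ ≤ θ * ‖f‖) (f : C(Fin n → I, ℝ)) :
    ∃ g : Fin (2 * n + 1) → BoundedContinuousFunction ℝ ℝ, f = T ψ g := by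
  choose G hG1 hG2 using H
  let r : ℕ → C(Fin n → I, ℝ) := fun k => Nat.rec f (fun _ h => h - T ψ (G h)) k
  have hr : ∀ k, r (k + 1) = r k - T ψ (G (r k)) := fun k => rfl
  have hrn : ∀ k, ‖r k‖ ≤ θ ^ k * ‖f‖ := by
    intro k
    induction k with
    | zero => simp [r]
    | succ k ih =>
      rw [hr]
      refine (hG2 _).trans ?_
      rw [pow_succ, mul_comm (θ ^ k), mul_assoc]
      gcongr
  have hsum : Summable fun k => G (r k) := by
    refine Summable.of_norm_bounded (g := fun k => 2 * (θ ^ k * ‖f‖)) ?_ ?_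
    · exact ((summable_geometric_of_lt_one h0 h1).mul_right _).mul_left _
    · intro k
      refine (hG1 _).trans ?_
      gcongr
      exact hrn k
  obtain ⟨g, hg⟩ := hsum
  refine ⟨g, ?_⟩
  ext x
  have ht := hg.tendsto_sum_nat
  have hpart : ∀ K, T ψ (∑ k ∈ Finset.range K, G (r k)) x = f x - r K x := by
    intro K
    induction K with
    | zero => simp [T_apply, r]
    | succ K ih =>
      have : T ψ (∑ k ∈ Finset.range (K + 1), G (r k)) x =
        T ψ (∑ k ∈ Finset.range K, G (r k)) x + T ψ (G (r K)) x := by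
        rw [Finset.sum_range_succ]
        simp only [T_apply, Pi.add_apply, BoundedContinuousFunction.add_apply,
          Finset.sum_add_distrib]
      rw [this, ih, hr, ContinuousMap.sub_apply]; ring
  have hTc : Continuous fun g : Fin (2 * n + 1) → BoundedContinuousFunction ℝ ℝ => T ψ g x := by
    simp only [T_apply]
    refine continuous_finsetSum _ fun q _ => ?_
    exact (continuous_eval_const _).comp (continuous_apply q)
  have l1 := (hTc.tendsto g).comp ht
  have l2 : Filter.Tendsto (fun K => f x - r K x) Filter.atTop (nhds (f x - 0)) := by
    refine tendsto_const_nhds.sub ?_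
    have hz : Filter.Tendsto (fun K => θ ^ K * ‖f‖) Filter.atTop (nhds 0) := by
      simpa using (tendsto_pow_atTop_nhds_zero_of_lt_one h0 h1).mul_const ‖f‖
    exact squeeze_zero_norm (fun K => ((r K).norm_coe_le_norm x).trans (hrn K)) hz
  rw [sub_zero] at l2
  refine tendsto_nhds_unique l2 (l1.congr fun K => ?_)
  exact hpart K

end KST

/-- **Kolmogorov Superposition Theorem.** For each fixed `n ≥ 2` there are
`n * (2n+1)` continuous maps `ψ p q : [0,1] → ℝ` such that every continuous
`f : [0,1]^n → ℝ` can be written as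
`f x = ∑ q, g q (∑ p, ψ p q (x p))` for some continuous `g q : ℝ → ℝ`. -/
theorem kolmogorov_superposition (n : ℕ) (hn : 2 ≤ n) :
    ∃ ψ : Fin n → Fin (2 * n + 1) → (Set.Icc (0 : ℝ) 1 → ℝ),
      (∀ p q, Continuous (ψ p q)) ∧
      ∀ f : (Fin n → Set.Icc (0 : ℝ) 1) → ℝ, Continuous f →
        ∃ g : Fin (2 * n + 1) → ℝ → ℝ,
          (∀ q, Continuous (g q)) ∧
          ∀ x : Fin n → Set.Icc (0 : ℝ) 1,
            f x = ∑ q : Fin (2 * n + 1), g q (∑ p : Fin n, ψ p q (x p)) := by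
  obtain ⟨ψ, hψ⟩ := KST.exists_good n
  refine ⟨fun p q => ψ p q, fun p q => (ψ p q).continuous, fun f hf => ?_⟩
  have hκ : 1 / (12 * ((n : ℝ) + 1)) ≤ 1 / 12 := by
    apply one_div_le_one_div_of_le (by norm_num)
    linarith [(n.cast_nonneg : (0:ℝ) ≤ n)]
  have hκp : 0 < 1 / (12 * ((n : ℝ) + 1)) := by positivity
  obtain ⟨g, hg⟩ := KST.iterate n ψ _ (by linarith) (by linarith) hψ ⟨f, hf⟩
  refine ⟨fun q => g q, fun q => (g q).continuous, fun x => ?_⟩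
  have := congrArg (fun h : C(Fin n → KST.I, ℝ) => h x) hg
  simpa [KST.T_apply] using this
end

section
/- For every m ∈ ℕ, m ≥ 1, the space ℝ^m has a finite basic family consisting of 2m+1 functions; that is, there exist continuous φ^1,…,φ^{2m+1} : ℝ^m → ℝ such that every continuous f : ℝ^m → ℝ can be written f = Σ_{q=1}^{2m+1} g_q ∘ φ^q for some continuous g_1,…,g_{2m+1} : ℝ → ℝ. -/
namespace KST

open Set

lemma exists_small {ι : Type*} (Z : Finset ι) (e : ι → ℝ) (h : ∀ z ∈ Z, 0 < e z) :
    ∃ σ > 0, ∀ z ∈ Z, σ ≤ e z := by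
  classical
  induction Z using Finset.induction_on with
  | empty => exact ⟨1, one_pos, by simp⟩
  | insert a s ha ih =>
    obtain ⟨σ, hσ, h1⟩ := ih (fun z hz => h z (Finset.mem_insert_of_mem hz))
    refine ⟨min σ (e a), lt_min hσ (h a (Finset.mem_insert_self _ _)), ?_⟩
    intro z hz
    rcases Finset.mem_insert.1 hz with rfl | hz
    · exact min_le_right _ _
    · exact (min_le_left _ _).trans (h1 z hz)

lemma exists_inj {ι : Type*} (Z : Finset ι) (lo hi : ι → ℝ) (h : ∀ z ∈ Z, lo z < hi z) :
    ∃ s : ι → ℝ, (∀ z ∈ Z, lo z < s z ∧ s z < hi z) ∧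
      ∀ z ∈ Z, ∀ z' ∈ Z, z ≠ z' → s z ≠ s z' := by
  classical
  induction Z using Finset.induction_on with
  | empty => exact ⟨fun _ => 0, by simp, by simp⟩
  | insert a Z ha ih =>
    obtain ⟨s, h1, h2⟩ := ih (fun z hz => h z (Finset.mem_insert_of_mem hz))
    have hinf : (Ioo (lo a) (hi a)).Infinite := Ioo_infinite (h a (Finset.mem_insert_self _ _))
    obtain ⟨y, hy, hy'⟩ := hinf.exists_notMem_finset (Z.image s)
    have hne : ∀ z ∈ Z, z ≠ a := fun z hz h => ha (h ▸ hz)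
    have hyz : ∀ z ∈ Z, s z ≠ y := fun z hz h => hy' (Finset.mem_image.2 ⟨z, hz, h⟩)
    refine ⟨Function.update s a y, ?_, ?_⟩
    · intro z hz
      rcases Finset.mem_insert.1 hz with rfl | hz
      · simpa using hy
      · rw [Function.update_of_ne (hne z hz)]; exact h1 z hz
    · intro z hz z' hz' hzz
      rcases Finset.mem_insert.1 hz with hza | hz2 <;> rcases Finset.mem_insert.1 hz' with hza' | hz2'
      · exact absurd (hza.trans hza'.symm) hzz
      · rw [hza, Function.update_self, Function.update_of_ne (hne z' hz2')]
        exact (hyz z' hz2').symm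
      · rw [hza', Function.update_self, Function.update_of_ne (hne z hz2)]; exact (hyz z hz2)
      · rw [Function.update_of_ne (hne z hz2), Function.update_of_ne (hne z' hz2')]
        exact h2 z hz2 z' hz2' hzz

lemma exists_sep {ι : Type*} (Z : Finset ι) (s e : ι → ℝ) (h : ∀ z ∈ Z, 0 < e z)
    (hs : ∀ z ∈ Z, ∀ z' ∈ Z, z ≠ z' → s z ≠ s z') (ε : ℝ) (hε : 0 < ε) :
    ∃ σ > 0, σ ≤ ε ∧ (∀ z ∈ Z, σ ≤ e z) ∧
      ∀ z ∈ Z, ∀ z' ∈ Z, z ≠ z' → 4 * σ ≤ |s z - s z'| := by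
  classical
  obtain ⟨σ₁, h1, h1'⟩ := exists_small Z e h
  obtain ⟨σ₂, h2, h2'⟩ := exists_small Z.offDiag (fun q => |s q.1 - s q.2| / 4) (by
    intro q hq
    rw [Finset.mem_offDiag] at hq
    have := hs q.1 hq.1 q.2 hq.2.1 hq.2.2
    have : 0 < |s q.1 - s q.2| := abs_pos.2 (sub_ne_zero.2 this)
    positivity)
  refine ⟨min ε (min σ₁ σ₂), by positivity, min_le_left _ _, ?_, ?_⟩
  · intro z hz
    exact ((min_le_right _ _).trans (min_le_left _ _)).trans (h1' z hz)
  · intro z hz z' hz' hne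
    have h3 := h2' (z, z') (Finset.mem_offDiag.2 ⟨hz, hz', hne⟩)
    have h4 : min ε (min σ₁ σ₂) ≤ σ₂ := (min_le_right _ _).trans (min_le_right _ _)
    simp only at h3
    linarith

/-- sums in which at most one term is nonzero -/
lemma sum_single {ι : Type*} (Z : Finset ι) (F : ι → ℝ) (z₀ : ι) (hz : z₀ ∈ Z)
    (h : ∀ z ∈ Z, z ≠ z₀ → F z = 0) : ∑ z ∈ Z, F z = F z₀ :=
  Finset.sum_eq_single z₀ h (fun h' => absurd hz h')

lemma abs_sum_le_of_disj {ι : Type*} (Z : Finset ι) (v T : ι → ℝ) (M : ℝ) (hM : 0 ≤ M)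
    (hv : ∀ z, |v z| ≤ M) (hT : ∀ z ∈ Z, 0 ≤ T z ∧ T z ≤ 1)
    (hd : ∀ z ∈ Z, ∀ z' ∈ Z, T z ≠ 0 → T z' ≠ 0 → z = z') :
    |∑ z ∈ Z, v z * T z| ≤ M := by
  by_cases h : ∃ z ∈ Z, T z ≠ 0
  · obtain ⟨z, hz, hne⟩ := h
    rw [sum_single Z _ z hz]
    · rw [abs_mul, abs_of_nonneg (hT z hz).1]
      calc |v z| * T z ≤ M * 1 := mul_le_mul (hv z) (hT z hz).2 (hT z hz).1 hM
        _ = M := mul_one M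
    · intro z' hz' hne'
      by_cases h0 : T z' = 0
      · simp [h0]
      · exact absurd (hd z' hz' z hz h0 hne) hne'
  · push Not at h
    rw [Finset.sum_eq_zero]
    · simpa
    · intro z hz; simp [h z hz]

variable {X : Type*} [NormedAddCommGroup X]

def Wall (φ : X → ℝ) : Prop :=
  ∀ x, ∀ j : ℤ, (‖x‖ ≤ j → φ x ≤ j) ∧ ((j : ℝ) ≤ ‖x‖ → (j : ℝ) ≤ φ x)

def PropS {ι : Type*} (Z : Finset ι) (u : ι → X → ℝ) (pt : ι → X) (φ : X → ℝ) : Prop :=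
  ∀ v : ι → ℝ, ∀ M : ℝ, 0 ≤ M → (∀ z, |v z| ≤ M) → ∃ g : ℝ → ℝ, Continuous g ∧
    (∀ t, |g t| ≤ M) ∧ (∀ z ∈ Z, ∀ x, u z x = 1 → g (φ x) = v z) ∧
    ∀ j j' : ℤ, (∀ z ∈ Z, v z ≠ 0 → (j : ℝ) ≤ ‖pt z‖ ∧ ‖pt z‖ ≤ j') →
      ∀ t : ℝ, (t ≤ j ∨ (j' : ℝ) ≤ t) → g t = 0

structure Cells {ι : Type*} (Z : Finset ι) (u : ι → X → ℝ) (pt : ι → X) : Prop where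
  cont : ∀ z, Continuous (u z)
  nonneg : ∀ z x, 0 ≤ u z x
  le_one : ∀ z x, u z x ≤ 1
  disj : ∀ z z' x, u z x ≠ 0 → u z' x ≠ 0 → z = z'
  pt_one : ∀ z, u z (pt z) = 1

noncomputable def pl (σ s t : ℝ) : ℝ := max 0 (min 1 (2 - |t - s| / σ))

lemma pl_cont (σ s : ℝ) : Continuous (pl σ s) := by
  unfold pl; fun_prop

lemma pl_mem (σ s t : ℝ) : 0 ≤ pl σ s t ∧ pl σ s t ≤ 1 :=
  ⟨le_max_left _ _, max_le zero_le_one (min_le_left _ _)⟩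

lemma pl_one {σ s t : ℝ} (hσ : 0 < σ) (h : |t - s| ≤ σ) : pl σ s t = 1 := by
  have : |t - s| / σ ≤ 1 := (div_le_one hσ).2 h
  unfold pl
  rw [min_eq_left (by linarith), max_eq_right zero_le_one]

lemma pl_ne {σ s t : ℝ} (hσ : 0 < σ) (h : pl σ s t ≠ 0) : |t - s| < 2 * σ := by
  by_contra hc
  push Not at hc
  have : 2 ≤ |t - s| / σ := by rw [le_div_iff₀ hσ]; exact hc
  apply h
  unfold pl
  rw [max_eq_left]
  exact (min_le_right _ _).trans (by linarith)

lemma stepS {ι : Type*} (Z : Finset ι) (u : ι → X → ℝ) (pt : ι → X) (hC : Cells Z u pt)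
    (φ : X → ℝ) (hφ : Continuous φ) (hW : Wall φ) (η : ℝ) (hη : 0 < η)
    (hdiam : ∀ z ∈ Z, ∀ x, u z x ≠ 0 → |φ x - φ (pt z)| ≤ η)
    (hcell : ∀ z ∈ Z, ∀ x y, u z x ≠ 0 → u z y ≠ 0 → ∀ j : ℤ, ‖x‖ ≤ j → ‖y‖ < j) :
    ∃ φ' : X → ℝ, Continuous φ' ∧ Wall φ' ∧ (∀ x, |φ' x - φ x| ≤ 2 * η) ∧
      ∃ δ > 0, ∀ φ'' : X → ℝ, (∀ x, |φ'' x - φ' x| ≤ δ) → PropS Z u pt φ'' := by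
  have hne : ∀ z, u z (pt z) ≠ 0 := fun z => by rw [hC.pt_one]; exact one_ne_zero
  set J : ι → ℤ := fun z => ⌊‖pt z‖⌋ with hJ
  have hJ1 : ∀ z ∈ Z, (J z : ℝ) < ‖pt z‖ := by
    intro z hz
    rcases lt_or_eq_of_le (Int.floor_le ‖pt z‖) with h | h
    · exact h
    · exact absurd (hcell z hz _ _ (hne z) (hne z) (J z) h.ge) (by rw [not_lt]; exact h.le)
  have hJ2 : ∀ z, ‖pt z‖ < J z + 1 := fun z => Int.lt_floor_add_one _
  have hφ1 : ∀ z ∈ Z, (J z : ℝ) ≤ φ (pt z) := fun z hz => (hW _ _).2 (hJ1 z hz).le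
  have hφ2 : ∀ z, φ (pt z) ≤ (J z : ℝ) + 1 := fun z => by
    have := (hW (pt z) (J z + 1)).1 (by push_cast; exact (hJ2 z).le)
    push_cast at this; exact this
  obtain ⟨s, hs1, hs2⟩ := exists_inj Z (fun z => max (J z : ℝ) (φ (pt z) - η))
    (fun z => min ((J z : ℝ) + 1) (φ (pt z) + η)) (by
      intro z hz
      have := hφ1 z hz
      have := hφ2 z
      rw [lt_min_iff, max_lt_iff, max_lt_iff]
      refine ⟨⟨?_, ?_⟩, ?_, ?_⟩ <;> linarith)
  have hs3 : ∀ z ∈ Z, (J z : ℝ) < s z ∧ s z < J z + 1 ∧ |s z - φ (pt z)| ≤ η := by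
    intro z hz
    obtain ⟨h1, h2⟩ := hs1 z hz
    rw [max_lt_iff] at h1
    rw [lt_min_iff] at h2
    refine ⟨h1.1, h2.1, abs_le.2 ⟨?_, ?_⟩⟩ <;> linarith
  obtain ⟨σ, hσ, -, hσ1, hσ2⟩ := exists_sep Z s
    (fun z => min ((s z - J z) / 2) ((J z + 1 - s z) / 2)) (by
      intro z hz
      have := hs3 z hz
      apply lt_min <;> linarith) hs2 1 one_pos
  refine ⟨fun x => φ x + ∑ z ∈ Z, u z x * (s z - φ x), ?_, ?_, ?_, σ, hσ, ?_⟩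
  · have := hC.cont
    fun_prop
  · intro x j
    beta_reduce
    by_cases h : ∃ z ∈ Z, u z x ≠ 0
    · obtain ⟨z, hz, hzx⟩ := h
      rw [sum_single Z (fun z => u z x * (s z - φ x)) z hz (fun z' _ hne' => by
        by_cases h0 : u z' x = 0
        · simp [h0]
        · exact absurd (hC.disj _ _ _ h0 hzx) hne')]
      have h0 := hC.nonneg z x
      have h1 := hC.le_one z x
      have e : φ x + u z x * (s z - φ x) = (1 - u z x) * φ x + u z x * s z := by ring
      constructor
      · intro hj
        have h2 := (hW x j).1 hj
        have h3 : s z ≤ j := by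
          have := hcell z hz x (pt z) hzx (hne z) j hj
          have h4 : J z < j := by
            have := (hJ1 z hz).trans this
            exact_mod_cast this
          have h5 : (J z : ℝ) + 1 ≤ j := by exact_mod_cast h4
          linarith [(hs3 z hz).2.1]
        rw [e]; nlinarith
      · intro hj
        have h2 := (hW x j).2 hj
        have h3 : (j : ℝ) ≤ s z := by
          have : ¬ (‖pt z‖ ≤ j) := fun hh => by
            have := hcell z hz (pt z) x (hne z) hzx j hh
            linarith
          push Not at this
          have h4 : j ≤ J z := Int.le_floor.2 this.le
          have h5 : (j : ℝ) ≤ J z := by exact_mod_cast h4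
          linarith [(hs3 z hz).1]
        rw [e]; nlinarith
    · push Not at h
      rw [Finset.sum_eq_zero (fun z hz => by simp [h z hz]), add_zero]
      exact hW x j
  · intro x
    beta_reduce
    by_cases h : ∃ z ∈ Z, u z x ≠ 0
    · obtain ⟨z, hz, hzx⟩ := h
      simp only [add_sub_cancel_left]
      rw [sum_single Z (fun z => u z x * (s z - φ x)) z hz (fun z' _ hne' => by
        by_cases h0 : u z' x = 0
        · simp [h0]
        · exact absurd (hC.disj _ _ _ h0 hzx) hne')]
      rw [abs_mul, abs_of_nonneg (hC.nonneg z x)]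
      have h3 := abs_le.1 (hs3 z hz).2.2
      have h4 := abs_le.1 (hdiam z hz x hzx)
      have h5 : |s z - φ x| ≤ 2 * η := abs_le.2 ⟨by linarith, by linarith⟩
      nlinarith [hC.le_one z x, hC.nonneg z x, abs_nonneg (s z - φ x)]
    · push Not at h
      rw [Finset.sum_eq_zero (fun z hz => by simp [h z hz])]
      simp; positivity
  · intro φ'' hφ'' v M hM hv
    refine ⟨fun t => ∑ z ∈ Z, v z * pl σ (s z) t, ?_, ?_, ?_, ?_⟩
    · have := fun z => pl_cont σ (s z)
      fun_prop
    · intro t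
      apply abs_sum_le_of_disj Z v _ M hM hv (fun z _ => pl_mem _ _ _)
      intro z hz z' hz' h h'
      by_contra hc
      have h1 := abs_lt.1 (pl_ne hσ h)
      have h2 := abs_lt.1 (pl_ne hσ h')
      have h3 := hσ2 z hz z' hz' hc
      have : |s z - s z'| < 4 * σ := abs_lt.2 ⟨by linarith, by linarith⟩
      linarith
    · intro z hz x hx
      have hzx : u z x ≠ 0 := by rw [hx]; exact one_ne_zero
      have e : |φ'' x - s z| ≤ σ := by
        have := hφ'' x
        beta_reduce at this
        rw [sum_single Z (fun z => u z x * (s z - φ x)) z hz (fun z' _ hne' => by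
          by_cases h0 : u z' x = 0
          · simp [h0]
          · exact absurd (hC.disj _ _ _ h0 hzx) hne'), hx] at this
        simpa using this
      have h1 : pl σ (s z) (φ'' x) = 1 := pl_one hσ e
      show ∑ z ∈ Z, v z * pl σ (s z) (φ'' x) = v z
      rw [sum_single Z _ z hz, h1, mul_one]
      intro z' hz' hne'
      by_contra h
      have h2 := abs_lt.1 (pl_ne hσ (right_ne_zero_of_mul h))
      have e' := abs_le.1 e
      have h3 := hσ2 z' hz' z hz hne'
      have : |s z' - s z| < 4 * σ := abs_lt.2 ⟨by linarith, by linarith⟩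
      linarith
    · intro j j' hj t ht
      apply Finset.sum_eq_zero
      intro z hz
      by_contra h
      obtain ⟨hj1, hj2⟩ := hj z hz (left_ne_zero_of_mul h)
      have h2 := abs_lt.1 (pl_ne hσ (right_ne_zero_of_mul h))
      have h3 := le_min_iff.1 (hσ1 z hz)
      have h4 : j ≤ J z := Int.le_floor.2 hj1
      have h4' : (j : ℝ) ≤ J z := by exact_mod_cast h4
      have h5 : J z < j' := by
        have := (hJ1 z hz).trans_le hj2
        exact_mod_cast this
      have h5' : (J z : ℝ) + 1 ≤ j' := by exact_mod_cast h5
      rcases ht with ht | ht <;> linarith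

end KST

namespace KST

open Set

noncomputable def ramp (c σ κ : ℝ) : ℝ := max 0 (min (κ - c) σ)

lemma ramp_cont (c σ : ℝ) : Continuous (ramp c σ) := by unfold ramp; fun_prop

lemma ramp_nonneg (c σ κ : ℝ) : 0 ≤ ramp c σ κ := le_max_left _ _

lemma ramp_le {σ : ℝ} (hσ : 0 < σ) (c κ : ℝ) : ramp c σ κ ≤ σ := max_le hσ.le (min_le_right _ _)

lemma ramp_zero {c σ κ : ℝ} (h : κ ≤ c) : ramp c σ κ = 0 :=
  max_eq_left ((min_le_left _ _).trans (by linarith))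

lemma ramp_top {c σ κ : ℝ} (hσ : 0 < σ) (h : c + σ ≤ κ) : ramp c σ κ = σ := by
  unfold ramp; rw [min_eq_right (by linarith), max_eq_right hσ.le]

lemma ramp_mid {c σ κ : ℝ} (h : c ≤ κ) (h' : κ ≤ c + σ) : ramp c σ κ = κ - c := by
  unfold ramp; rw [min_eq_left (by linarith), max_eq_right (by linarith)]

lemma ramp_slope {σ : ℝ} (hσ : 0 < σ) (c κ s : ℝ) (hs : s = 1 ∨ s = -1) :
    ∃ e : ℕ, ∃ δ > 0, ∀ t, 0 ≤ t → t ≤ δ → ramp c σ (κ + s * t) = ramp c σ κ + s * (e * t) := by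
  rcases hs with rfl | rfl
  · rcases lt_or_ge κ c with h | h
    · refine ⟨0, c - κ, by linarith, fun t h0 h1 => ?_⟩
      rw [ramp_zero (by linarith), ramp_zero (by linarith)]; simp
    · rcases lt_or_ge κ (c + σ) with h' | h'
      · refine ⟨1, c + σ - κ, by linarith, fun t h0 h1 => ?_⟩
        rw [ramp_mid (by linarith) (by linarith), ramp_mid (by linarith) (by linarith)]
        push_cast; ring
      · refine ⟨0, 1, by linarith, fun t h0 h1 => ?_⟩
        rw [ramp_top hσ (by linarith), ramp_top hσ (by linarith)]; simp
  · rcases le_or_gt κ c with h | h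
    · refine ⟨0, 1, by linarith, fun t h0 h1 => ?_⟩
      rw [ramp_zero (by linarith), ramp_zero (by linarith)]; simp
    · rcases le_or_gt κ (c + σ) with h' | h'
      · refine ⟨1, κ - c, by linarith, fun t h0 h1 => ?_⟩
        rw [ramp_mid (by linarith) (by linarith), ramp_mid (by linarith) (by linarith)]
        push_cast; ring
      · refine ⟨0, κ - c - σ, by linarith, fun t h0 h1 => ?_⟩
        rw [ramp_top hσ (by linarith), ramp_top hσ (by linarith)]; simp

noncomputable def rho {ι : Type*} (Z : Finset ι) (k : ι → ℝ) (σ κ : ℝ) : ℝ :=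
  κ - 2 * ∑ z ∈ Z, ramp (k z) σ κ

lemma rho_cont {ι : Type*} (Z : Finset ι) (k : ι → ℝ) (σ : ℝ) : Continuous (rho Z k σ) := by
  unfold rho
  have := fun z => ramp_cont (k z) σ
  fun_prop

lemma rho_close {ι : Type*} (Z : Finset ι) (k : ι → ℝ) {σ : ℝ} (hσ : 0 < σ) (κ : ℝ) :
    |rho Z k σ κ - κ| ≤ 2 * (Z.card * σ) := by
  have h1 : 0 ≤ ∑ z ∈ Z, ramp (k z) σ κ := Finset.sum_nonneg fun z _ => ramp_nonneg _ _ _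
  have h2 : ∑ z ∈ Z, ramp (k z) σ κ ≤ Z.card * σ := by
    have := Finset.sum_le_card_nsmul Z (fun z => ramp (k z) σ κ) σ (fun z _ => ramp_le hσ _ _)
    simpa using this
  unfold rho
  rw [abs_le]; constructor <;> linarith

lemma sum_slope {ι : Type*} (Z : Finset ι) (k : ι → ℝ) {σ : ℝ} (hσ : 0 < σ) (κ s : ℝ)
    (hs : s = 1 ∨ s = -1) :
    ∃ E : ℕ, ∃ δ > 0, ∀ t, 0 ≤ t → t ≤ δ →
      ∑ z ∈ Z, ramp (k z) σ (κ + s * t) = ∑ z ∈ Z, ramp (k z) σ κ + s * (E * t) := by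
  classical
  induction Z using Finset.induction_on with
  | empty => exact ⟨0, 1, one_pos, by simp⟩
  | insert a Z ha ih =>
    obtain ⟨E, δ, hδ, h⟩ := ih
    obtain ⟨e, δ', hδ', h'⟩ := ramp_slope hσ (k a) κ s hs
    refine ⟨E + e, min δ δ', lt_min hδ hδ', fun t h0 h1 => ?_⟩
    rw [Finset.sum_insert ha, Finset.sum_insert ha, h t h0 (h1.trans (min_le_left _ _)),
      h' t h0 (h1.trans (min_le_right _ _))]
    push_cast; ring

lemma rho_slope {ι : Type*} (Z : Finset ι) (k : ι → ℝ) {σ : ℝ} (hσ : 0 < σ) (κ s : ℝ)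
    (hs : s = 1 ∨ s = -1) :
    ∃ μ : ℝ, 1 ≤ |μ| ∧ ∃ δ > 0, ∀ t, 0 ≤ t → t ≤ δ →
      rho Z k σ (κ + s * t) = rho Z k σ κ + s * (μ * t) := by
  obtain ⟨E, δ, hδ, h⟩ := sum_slope Z k hσ κ s hs
  refine ⟨((1 - 2 * E : ℤ) : ℝ), ?_, δ, hδ, fun t h0 h1 => ?_⟩
  · have : (1 : ℤ) ≤ |1 - 2 * (E : ℤ)| := Int.one_le_abs (by omega)
    exact_mod_cast this
  · unfold rho
    rw [h t h0 h1]; push_cast; ring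

lemma rho_tooth {ι : Type*} (Z : Finset ι) (k : ι → ℝ) {σ : ℝ} (hσ : 0 < σ)
    (hsep : ∀ z ∈ Z, ∀ z' ∈ Z, z ≠ z' → 4 * σ ≤ |k z - k z'|) (z : ι) (hz : z ∈ Z) (y : ℝ)
    (hy : |y| ≤ σ) : rho Z k σ (k z + y) = rho Z k σ (k z) - |y| := by
  classical
  unfold rho
  rw [← Finset.add_sum_erase Z _ hz, ← Finset.add_sum_erase Z (fun x => ramp (k x) σ (k z)) hz]
  have e : ∑ x ∈ Z.erase z, ramp (k x) σ (k z + y) = ∑ x ∈ Z.erase z, ramp (k x) σ (k z) := by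
    apply Finset.sum_congr rfl
    intro x hx
    have h1 := hsep z hz x (Finset.mem_of_mem_erase hx) (Finset.ne_of_mem_erase hx).symm
    have h2 := abs_le.1 hy
    rcases le_abs.1 h1 with h | h
    · rw [ramp_top hσ (by linarith), ramp_top hσ (by linarith)]
    · rw [ramp_zero (by linarith), ramp_zero (by linarith)]
  rw [e, ramp_zero (le_refl (k z))]
  have h2 := abs_le.1 hy
  rcases le_total 0 y with h | h
  · rw [ramp_mid (by linarith) (by linarith), abs_of_nonneg h]; ring
  · rw [ramp_zero (by linarith), abs_of_nonpos h]; ring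

def GoodPt (A G : ℝ → ℝ) (α γ : ℝ) : Prop :=
  ∀ η > 0, ∃ δ > 0, ∃ P Q : ℝ → ℝ, ∃ s : ℝ, (s = 1 ∨ s = -1) ∧ Continuous P ∧ Continuous Q ∧
    P 0 = α ∧ Q 0 = γ ∧ ∀ t, 0 ≤ t → t ≤ δ → |P t - α| ≤ η ∧ |Q t - γ| ≤ η ∧
      A (P t) = A α + s * t ∧ G (Q t) = G γ + s * t

lemma GoodPt.comp {ι : Type*} {A G : ℝ → ℝ} {α γ : ℝ} (h : GoodPt A G α γ) (he : A α = G γ)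
    (Z : Finset ι) (k : ι → ℝ) {σ : ℝ} (hσ : 0 < σ) :
    GoodPt (fun t => rho Z k σ (A t)) (fun t => rho Z k σ (G t)) α γ := by
  intro η hη
  obtain ⟨δ, hδ, P, Q, s, hs, hP, hQ, hP0, hQ0, hh⟩ := h η hη
  obtain ⟨μ, hμ, δ', hδ', hr⟩ := rho_slope Z k hσ (A α) s hs
  have hμ0 : 0 < |μ| := by linarith
  refine ⟨min δ δ', lt_min hδ hδ', fun t => P (t / |μ|), fun t => Q (t / |μ|), s * (μ / |μ|), ?_,
    by fun_prop, by fun_prop, by simpa using hP0, by simpa using hQ0, ?_⟩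
  · have : μ / |μ| = 1 ∨ μ / |μ| = -1 := by
      rcases le_total 0 μ with h | h
      · left; rw [abs_of_nonneg h] at *; exact div_self hμ0.ne'
      · right; rw [abs_of_nonpos h] at *; rw [div_neg, div_self (by linarith)]
    rcases hs with rfl | rfl <;> rcases this with h | h <;> rw [h] <;> simp
  · intro t h0 h1
    have ht : t / |μ| ≤ t := div_le_self h0 hμ
    have ht0 : 0 ≤ t / |μ| := by positivity
    obtain ⟨a1, a2, a3, a4⟩ := hh (t / |μ|) ht0 (ht.trans (h1.trans (min_le_left _ _)))
    have := hr (t / |μ|) ht0 (ht.trans (h1.trans (min_le_right _ _)))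
    refine ⟨a1, a2, ?_, ?_⟩
    · beta_reduce
      rw [a3, this]; ring
    · beta_reduce
      rw [a4, ← he, this]; ring

lemma GoodPt.move {A G : ℝ → ℝ} {P Q : ℝ → ℝ} {κ s δ t₀ : ℝ} (hs : s = 1 ∨ s = -1)
    (hP : Continuous P) (hQ : Continuous Q)
    (hA : ∀ t, 0 ≤ t → t ≤ δ → A (P t) = κ + s * t)
    (hG : ∀ t, 0 ≤ t → t ≤ δ → G (Q t) = κ + s * t) (h0 : 0 ≤ t₀) (h1 : t₀ < δ) :
    GoodPt A G (P t₀) (Q t₀) := by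
  intro η hη
  obtain ⟨δ1, hδ1, e1⟩ := Metric.continuous_iff.1 hP t₀ η hη
  obtain ⟨δ2, hδ2, e2⟩ := Metric.continuous_iff.1 hQ t₀ η hη
  refine ⟨min (min (δ1 / 2) (δ2 / 2)) (δ - t₀), by
      refine lt_min (by positivity) (by linarith), fun t => P (t₀ + t),
    fun t => Q (t₀ + t), s, hs, by fun_prop, by fun_prop, by simp, by simp, ?_⟩
  intro t ht0 ht
  rw [le_min_iff, le_min_iff] at ht
  refine ⟨?_, ?_, ?_, ?_⟩
  · have := e1 (t₀ + t) (by rw [Real.dist_eq, add_sub_cancel_left, abs_of_nonneg ht0]; linarith)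
    exact this.le
  · have := e2 (t₀ + t) (by rw [Real.dist_eq, add_sub_cancel_left, abs_of_nonneg ht0]; linarith)
    exact this.le
  · rw [hA _ (by linarith) (by linarith), hA _ h0 h1.le]; ring
  · rw [hG _ (by linarith) (by linarith), hG _ h0 h1.le]; ring

lemma GoodPt.tooth {ι : Type*} {A G : ℝ → ℝ} {P Q : ℝ → ℝ} {κ s δ t₀ w : ℝ} (hs : s = 1 ∨ s = -1)
    (hP : Continuous P) (hQ : Continuous Q)
    (hA : ∀ t, 0 ≤ t → t ≤ δ → A (P t) = κ + s * t)
    (hG : ∀ t, 0 ≤ t → t ≤ δ → G (Q t) = κ + s * t)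
    (Z : Finset ι) (k : ι → ℝ) {σ : ℝ} (hσ : 0 < σ)
    (hsep : ∀ z ∈ Z, ∀ z' ∈ Z, z ≠ z' → 4 * σ ≤ |k z - k z'|) (z : ι) (hz : z ∈ Z)
    (hk : k z = κ + s * t₀) (hw : 0 < w) (hw' : w ≤ σ) (h0 : 0 ≤ t₀ - w) (h1 : t₀ + w ≤ δ) :
    (rho Z k σ (A (P (t₀ + w))) = rho Z k σ (G (Q (t₀ - w)))) ∧
    GoodPt (fun t => rho Z k σ (A t)) (fun t => rho Z k σ (G t)) (P (t₀ + w)) (Q (t₀ - w)) := by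
  have kA : ∀ y, 0 ≤ y → y ≤ w → rho Z k σ (A (P (t₀ + y))) = rho Z k σ (k z) - y := by
    intro y hy hyw
    have e : |s * y| = y := by
      rcases hs with rfl | rfl <;> simp [abs_of_nonneg hy]
    rw [hA _ (by linarith) (by linarith),
      show κ + s * (t₀ + y) = k z + s * y by rw [hk]; ring,
      rho_tooth Z k hσ hsep z hz _ (by rw [e]; linarith), e]
  have kG : ∀ y, 0 ≤ y → y ≤ w → rho Z k σ (G (Q (t₀ - y))) = rho Z k σ (k z) - y := by
    intro y hy hyw
    have e : |-(s * y)| = y := by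
      rcases hs with rfl | rfl <;> simp [abs_of_nonneg hy]
    rw [hG _ (by linarith) (by linarith),
      show κ + s * (t₀ - y) = k z + -(s * y) by rw [hk]; ring,
      rho_tooth Z k hσ hsep z hz _ (by rw [e]; linarith), e]
  refine ⟨by rw [kA w hw.le le_rfl, kG w hw.le le_rfl], ?_⟩
  intro η hη
  obtain ⟨δ1, hδ1, e1⟩ := Metric.continuous_iff.1 hP (t₀ + w) η hη
  obtain ⟨δ2, hδ2, e2⟩ := Metric.continuous_iff.1 hQ (t₀ - w) η hη
  refine ⟨min (min (δ1 / 2) (δ2 / 2)) w, by positivity, fun t => P (t₀ + (w - t)),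
    fun t => Q (t₀ - (w - t)), 1, Or.inl rfl, by fun_prop, by fun_prop, by simp, by simp, ?_⟩
  intro t ht0 ht
  rw [le_min_iff, le_min_iff] at ht
  refine ⟨?_, ?_, ?_, ?_⟩
  · refine (e1 _ ?_).le
    rw [Real.dist_eq, show t₀ + (w - t) - (t₀ + w) = -t by ring, abs_neg, abs_of_nonneg ht0]
    linarith
  · refine (e2 _ ?_).le
    rw [Real.dist_eq, show t₀ - (w - t) - (t₀ - w) = t by ring, abs_of_nonneg ht0]
    linarith
  · beta_reduce
    rw [kA _ (by linarith) (by linarith), kA w hw.le le_rfl]; ring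
  · beta_reduce
    rw [kG _ (by linarith) (by linarith), kG w hw.le le_rfl]; ring

end KST

namespace KST

open Set

variable {X : Type*} [NormedAddCommGroup X] [NormedSpace ℝ X]

noncomputable def tent (σ τ κ : ℝ) : ℝ := max 0 (1 - |κ - τ| / σ)

lemma tent_cont (σ τ : ℝ) : Continuous (tent σ τ) := by unfold tent; fun_prop

lemma tent_zero {σ τ κ : ℝ} (hσ : 0 < σ) (h : σ ≤ |κ - τ|) : tent σ τ κ = 0 := by
  have : 1 ≤ |κ - τ| / σ := by rw [le_div_iff₀ hσ]; linarith
  exact max_eq_left (by linarith)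

lemma tent_ne {σ τ κ : ℝ} (hσ : 0 < σ) (h : tent σ τ κ ≠ 0) : |κ - τ| < σ := by
  by_contra hc
  exact h (tent_zero hσ (not_lt.1 hc))

lemma tent_mem {σ τ κ : ℝ} (hσ : 0 < σ) : 0 ≤ tent σ τ κ ∧ tent σ τ κ ≤ 1 := by
  refine ⟨le_max_left _ _, max_le zero_le_one ?_⟩
  have : 0 ≤ |κ - τ| / σ := by positivity
  linarith

lemma tent_val {σ τ κ w : ℝ} (hσ : 0 < σ) (hw : 0 ≤ w) (h : |κ - τ| = σ * (1 - w)) :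
    tent σ τ κ = w := by
  unfold tent
  rw [h, mul_div_cancel_left₀ _ hσ.ne', max_eq_right (by linarith)]; ring

noncomputable def w1 (u : ℝ) : ℝ := max 0 (min 1 (3 * u - 1))
noncomputable def w2 (u : ℝ) : ℝ := max 0 (3 * u - 2)

noncomputable def rr {ι : Type*} (Z : Finset ι) (u : ι → X → ℝ) (pt : ι → X) (x : X) : X :=
  x + ∑ z ∈ Z, (min 1 (3 * u z x)) • (pt z - x)

noncomputable def upd {ι : Type*} (Z : Finset ι) (u : ι → X → ℝ) (pt : ι → X) (t : ι → ℝ)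
    (a : X → ℝ) (P : ι → ℝ → ℝ) (σ : ℝ) (x : X) : ℝ :=
  a (rr Z u pt x) + ∑ z ∈ Z, (P z (t z * w1 (u z x) + σ * w2 (u z x)) - P z 0)

lemma upd_cont {ι : Type*} {Z : Finset ι} {u : ι → X → ℝ} {pt : ι → X} (hC : Cells Z u pt)
    (t : ι → ℝ) {a : X → ℝ} (ha : Continuous a) {P : ι → ℝ → ℝ} (hP : ∀ z, Continuous (P z))
    (σ : ℝ) : Continuous (upd Z u pt t a P σ) := by
  unfold upd rr w1 w2
  have := hC.cont
  fun_prop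

lemma w1_zero : w1 0 = 0 := by unfold w1; norm_num
lemma w2_zero : w2 0 = 0 := by unfold w2; norm_num

lemma upd_cases {ι : Type*} {Z : Finset ι} {u : ι → X → ℝ} {pt : ι → X} (hC : Cells Z u pt)
    (t : ι → ℝ) (x : X) :
    (∃ y, (∀ z ∈ Z, w2 (u z x) = 0) ∧
      (y = x ∨ ∃ z ∈ Z, u z x ≠ 0 ∧ ‖y - pt z‖ ≤ ‖x - pt z‖) ∧
      ∀ a P σ, upd Z u pt t a P σ x = a y) ∨
    (∃ z ∈ Z, u z x ≠ 0 ∧ ∃ τ w : ℝ, 0 ≤ w ∧ w ≤ 1 ∧ 0 ≤ τ ∧ τ ≤ 1 ∧ (w = 0 ∨ τ = 1) ∧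
      (∀ z' ∈ Z, z' ≠ z → w2 (u z' x) = 0) ∧ w2 (u z x) = w ∧
      ∀ a P σ, P z 0 = a (pt z) → upd Z u pt t a P σ x = P z (t z * τ + σ * w)) := by
  by_cases h : ∃ z ∈ Z, u z x ≠ 0
  · obtain ⟨z, hz, hzx⟩ := h
    have hoth : ∀ z' ∈ Z, z' ≠ z → u z' x = 0 := fun z' _ hne => by
      by_contra h0
      exact hne (hC.disj _ _ _ h0 hzx)
    have hr : rr Z u pt x = x + (min 1 (3 * u z x)) • (pt z - x) := by
      unfold rr
      rw [Finset.sum_eq_single z (fun z' h1 h2 => by rw [hoth z' h1 h2]; simp)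
        (fun h' => absurd hz h')]
    have hsum : ∀ a P σ, upd Z u pt t a P σ x =
        a (rr Z u pt x) + (P z (t z * w1 (u z x) + σ * w2 (u z x)) - P z 0) := by
      intro a P σ
      unfold upd
      rw [Finset.sum_eq_single z (fun z' h1 h2 => by rw [hoth z' h1 h2, w1_zero, w2_zero]; simp)
        (fun h' => absurd hz h')]
    have h0 := hC.nonneg z x
    have h1 := hC.le_one z x
    by_cases h3 : 3 * u z x ≤ 1
    · left
      have e1 : w1 (u z x) = 0 := max_eq_left ((min_le_right _ _).trans (by linarith))
      have e2 : w2 (u z x) = 0 := max_eq_left (by linarith)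
      refine ⟨rr Z u pt x, ?_, Or.inr ⟨z, hz, hzx, ?_⟩, ?_⟩
      · intro z' hz'
        by_cases hne : z' = z
        · rw [hne, e2]
        · rw [hoth z' hz' hne, w2_zero]
      · rw [hr, show x + min 1 (3 * u z x) • (pt z - x) - pt z = (1 - min 1 (3 * u z x)) • (x - pt z)
          by module, norm_smul]
        have : ‖1 - min 1 (3 * u z x)‖ ≤ 1 := by
          rw [min_eq_right h3, Real.norm_eq_abs, abs_le]; constructor <;> linarith
        nlinarith [norm_nonneg (x - pt z)]
      · intro a P σ
        rw [hsum, e1, e2]; simp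
    · right
      push Not at h3
      have er : rr Z u pt x = pt z := by
        rw [hr, min_eq_left h3.le, one_smul]; abel
      refine ⟨z, hz, hzx, w1 (u z x), w2 (u z x), le_max_left _ _, max_le zero_le_one (by linarith),
        le_max_left _ _, max_le zero_le_one (min_le_left _ _), ?_, ?_, rfl, ?_⟩
      · rcases le_or_gt (3 * u z x) 2 with h | h
        · left; exact max_eq_left (by linarith)
        · right; unfold w1; rw [min_eq_left (by linarith)]; simp
      · intro z' hz' hne
        rw [hoth z' hz' hne, w2_zero]
      · intro a P σ hP
        rw [hsum, er, hP]; ring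
  · push Not at h
    left
    have hr : rr Z u pt x = x := by
      unfold rr
      rw [Finset.sum_eq_zero (fun z' h1 => by rw [h z' h1]; simp), add_zero]
    refine ⟨x, ?_, Or.inl rfl, ?_⟩
    · intro z hz; rw [h z hz, w2_zero]
    · intro a P σ
      unfold upd
      rw [hr, Finset.sum_eq_zero (fun z' h1 => by rw [h z' h1, w1_zero, w2_zero]; simp), add_zero]

structure TP (ρ : ℝ) (a c : X → ℝ) (A G : ℝ → ℝ) : Prop where
  conta : Continuous a
  contc : Continuous c
  contA : Continuous A
  contG : Continuous G
  hA : ∀ t, |A t - t| ≤ ρ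
  hG : ∀ t, |G t - t| ≤ ρ
  ha : ∀ x, |a x - ‖x‖| ≤ ρ
  hc : ∀ x, |c x - ‖x‖| ≤ ρ
  eq : ∀ x, A (a x) = G (c x)
  good : ∀ x, GoodPt A G (a x) (c x)

def PropP {ι : Type*} (Z : Finset ι) (u : ι → X → ℝ) (pt : ι → X) (ε : ℝ) (a c : X → ℝ) : Prop :=
  ∀ v : ι → ℝ, ∀ M : ℝ, 0 ≤ M → (∀ z, |v z| ≤ M) → ∃ ga gc : ℝ → ℝ, Continuous ga ∧
    Continuous gc ∧ (∀ t, |ga t| ≤ M) ∧ (∀ t, |gc t| ≤ M) ∧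
    (∀ x, |ga (a x) + gc (c x) - ∑ z ∈ Z, v z * w2 (u z x)| ≤ ε * M) ∧
    ∀ t : ℝ, (∀ z ∈ Z, v z ≠ 0 → 1 ≤ |t - ‖pt z‖|) → ga t = 0 ∧ gc t = 0

/-- uniform continuity of the tents composed with a map near the identity -/
lemma tent_unif {A : ℝ → ℝ} (hA : Continuous A) {ρ : ℝ} (hAt : ∀ t, |A t - t| ≤ ρ) {σ : ℝ}
    (hσ : 0 < σ) (τ : ℝ) (ε : ℝ) (hε : 0 < ε) :
    ∃ δ > 0, ∀ s t, |s - t| ≤ δ → |tent σ τ (A s) - tent σ τ (A t)| ≤ ε := by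
  have hcs : HasCompactSupport (fun t => tent σ τ (A t)) := by
    apply HasCompactSupport.intro (isCompact_Icc (a := τ - σ - ρ) (b := τ + σ + ρ))
    intro t ht
    by_contra h
    have h1 := abs_lt.1 (tent_ne hσ h)
    have h2 := abs_le.1 (hAt t)
    exact ht ⟨by linarith, by linarith⟩
  have hu : UniformContinuous (fun t => tent σ τ (A t)) :=
    hcs.uniformContinuous_of_continuous ((tent_cont σ τ).comp hA)
  obtain ⟨δ, hδ, h⟩ := Metric.uniformContinuous_iff.1 hu ε hε
  refine ⟨δ / 2, by positivity, fun s t hst => ?_⟩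
  have := h (a := s) (b := t) (by rw [Real.dist_eq]; linarith)
  exact this.le

lemma stepP {ι : Type*} {Z : Finset ι} {u : ι → X → ℝ} {pt : ι → X} (hC : Cells Z u pt)
    {ρ : ℝ} {a c : X → ℝ} {A G : ℝ → ℝ} (h : TP ρ a c A G) {η : ℝ} (hη : 0 < η)
    (hρ : ρ + 3 * η < 1 / 8) {ε : ℝ} (hε : 0 < ε)
    (hda : ∀ z ∈ Z, ∀ x y, u z x ≠ 0 → ‖y - pt z‖ ≤ ‖x - pt z‖ → |a y - a (pt z)| ≤ η)
    (hdc : ∀ z ∈ Z, ∀ x y, u z x ≠ 0 → ‖y - pt z‖ ≤ ‖x - pt z‖ → |c y - c (pt z)| ≤ η) :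
    ∃ a' c' A' G', TP (ρ + 3 * η) a' c' A' G' ∧ (∀ x, |a' x - a x| ≤ 3 * η) ∧
      (∀ x, |c' x - c x| ≤ 3 * η) ∧ ∃ δ > 0, ∀ a'' c'' : X → ℝ, (∀ x, |a'' x - a' x| ≤ δ) →
        (∀ x, |c'' x - c' x| ≤ δ) → PropP Z u pt ε a'' c'' := by
  obtain ⟨N, hN0, hN⟩ : ∃ N : ℝ, 0 ≤ N ∧ (Z.card : ℝ) = N := ⟨_, Nat.cast_nonneg _, rfl⟩
  have hgood := fun z => h.good (pt z) η hη
  choose δ₀ hδ₀ P Q s hs hP hQ hP0 hQ0 hPQ using hgood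
  set δ : ι → ℝ := fun z => min (δ₀ z) (1 / 8) with hδdef
  have hδ : ∀ z, 0 < δ z := fun z => lt_min (hδ₀ z) (by norm_num)
  have hδ8 : ∀ z, δ z ≤ 1 / 8 := fun z => min_le_right _ _
  have hδ1 : ∀ z, δ z ≤ δ₀ z := fun z => min_le_left _ _
  set κ : ι → ℝ := fun z => A (a (pt z)) with hκ
  have hAP : ∀ z t, 0 ≤ t → t ≤ δ z → A (P z t) = κ z + s z * t := fun z t h0 h1 =>
    (hPQ z t h0 (h1.trans (hδ1 z))).2.2.1
  have hGQ : ∀ z t, 0 ≤ t → t ≤ δ z → G (Q z t) = κ z + s z * t := fun z t h0 h1 => by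
    rw [(hPQ z t h0 (h1.trans (hδ1 z))).2.2.2, ← h.eq]
  have hPη : ∀ z t, 0 ≤ t → t ≤ δ z → |P z t - a (pt z)| ≤ η := fun z t h0 h1 =>
    (hPQ z t h0 (h1.trans (hδ1 z))).1
  have hQη : ∀ z t, 0 ≤ t → t ≤ δ z → |Q z t - c (pt z)| ≤ η := fun z t h0 h1 =>
    (hPQ z t h0 (h1.trans (hδ1 z))).2.1
  obtain ⟨k, hk1, hk2⟩ := exists_inj Z (fun z => min (κ z) (κ z + s z * δ z))
    (fun z => max (κ z) (κ z + s z * δ z)) (by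
      intro z hz
      have := hδ z
      rcases hs z with h | h <;> rw [h]
      · exact (min_le_left _ _).trans_lt (lt_of_lt_of_le (by linarith) (le_max_right _ _))
      · exact (min_le_right _ _).trans_lt (lt_of_lt_of_le (by linarith) (le_max_left _ _)))
  set t : ι → ℝ := fun z => s z * (k z - κ z) with ht
  have hkt : ∀ z, k z = κ z + s z * t z := by
    intro z; simp only [ht]
    rcases hs z with h | h <;> rw [h] <;> ring
  have ht1 : ∀ z ∈ Z, 0 < t z ∧ t z < δ z := by
    intro z hz
    have h1 := hk1 z hz
    have h2 := hδ z
    simp only [ht]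
    rcases hs z with h | h <;> rw [h] at h1 ⊢
    · rw [min_eq_left (by linarith), max_eq_right (by linarith)] at h1
      constructor <;> linarith
    · rw [min_eq_right (by linarith), max_eq_left (by linarith)] at h1
      constructor <;> linarith
  obtain ⟨σ, hσ, hσε, hσ1, hsep⟩ := exists_sep Z k
    (fun z => min (t z / 2) ((δ z - t z) / 2)) (by
      intro z hz
      have := ht1 z hz
      apply lt_min <;> linarith) hk2 (min (1 / 16) (3 * η / (2 * N + 1))) (by positivity)
  have hσ16 : σ ≤ 1 / 16 := hσε.trans (min_le_left _ _)
  have hσZ : 2 * (N * σ) ≤ 3 * η := by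
    have h1 := hσε.trans (min_le_right _ _)
    rw [le_div_iff₀ (by positivity)] at h1
    linarith
  have hσt : ∀ z ∈ Z, 2 * σ ≤ t z ∧ t z + 2 * σ ≤ δ z := by
    intro z hz
    have := le_min_iff.1 (hσ1 z hz)
    constructor <;> linarith
  have hs2 : ∀ z, s z * s z = 1 := by
    intro z; rcases hs z with h | h <;> rw [h] <;> norm_num
  have hsabs : ∀ z, |s z| = 1 := by
    intro z; rcases hs z with h | h <;> rw [h] <;> norm_num
  -- closeness
  have close : ∀ (b : X → ℝ) (R : ι → ℝ → ℝ) (σ' : ℝ), |σ'| ≤ σ →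
      (∀ z ∈ Z, ∀ x y, u z x ≠ 0 → ‖y - pt z‖ ≤ ‖x - pt z‖ → |b y - b (pt z)| ≤ η) →
      (∀ z, R z 0 = b (pt z)) → (∀ z t, 0 ≤ t → t ≤ δ z → |R z t - b (pt z)| ≤ η) →
      ∀ x, |upd Z u pt t b R σ' x - b x| ≤ 3 * η := by
    intro b R σ' hσ' hd hR0 hR x
    rcases upd_cases hC t x with ⟨y, -, hy, hu⟩ | ⟨z, hz, hzx, τ, w, hw0, hw1, hτ0, hτ1, hor, -, -, hu⟩
    · rw [hu]
      rcases hy with rfl | ⟨z, hz, hzx, hyx⟩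
      · simp; positivity
      · have h1 := abs_le.1 (hd z hz x y hzx hyx)
        have h2 := abs_le.1 (hd z hz x x hzx le_rfl)
        rw [abs_le]; constructor <;> linarith
    · rw [hu _ _ _ (hR0 z)]
      have h2 := abs_le.1 (hd z hz x x hzx le_rfl)
      obtain ⟨h4, h5⟩ := hσt z hz
      obtain ⟨h6, h7⟩ := abs_le.1 hσ'
      have h3 : |R z (t z * τ + σ' * w) - b (pt z)| ≤ η := by
        have h8 : σ' * w ≤ σ := by nlinarith
        have h9 : -σ ≤ σ' * w := by nlinarith
        have h10 : t z * τ ≤ t z := by nlinarith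
        apply hR z
        · rcases hor with rfl | rfl
          · simp only [mul_zero, add_zero]; nlinarith
          · linarith
        · linarith
      have h1 := abs_le.1 h3
      rw [abs_le]; constructor <;> linarith
  have keyT : ∀ x, ∀ z ∈ Z, tent σ (k z + s z * σ) (A (upd Z u pt t a P σ x)) -
      tent σ (k z + s z * σ) (G (upd Z u pt t c Q (-σ) x)) = w2 (u z x) := by
    intro x z hz
    rcases upd_cases hC t x with ⟨y, hw, hy, hu⟩ |
      ⟨z₀, hz₀, hzx, τ, w, hw0, hw1, hτ0, hτ1, hor, hoth, hw, hu⟩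
    · rw [hu, hu, h.eq, hw z hz, sub_self]
    · obtain ⟨h4, h5⟩ := hσt z₀ hz₀
      rw [hu _ _ _ (hP0 z₀), hu _ _ _ (hQ0 z₀)]
      rcases hor with rfl | rfl
      · have h6 : 0 ≤ t z₀ * τ := by nlinarith
        have h7 : t z₀ * τ ≤ δ z₀ := by nlinarith
        simp only [mul_zero, add_zero]
        rw [hAP _ _ h6 h7, hGQ _ _ h6 h7, sub_self]
        by_cases hne : z = z₀
        · rw [hne, hw]
        · rw [hoth z hz hne]
      · have hb : σ * w ≤ σ := by nlinarith
        have hb0 : 0 ≤ σ * w := by positivity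
        rw [hAP _ _ (by nlinarith) (by nlinarith), hGQ _ _ (by nlinarith) (by nlinarith)]
        have e1 : κ z₀ + s z₀ * (t z₀ * 1 + σ * w) = k z₀ + s z₀ * (σ * w) := by rw [hkt]; ring
        have e2 : κ z₀ + s z₀ * (t z₀ * 1 + -σ * w) = k z₀ - s z₀ * (σ * w) := by rw [hkt]; ring
        rw [e1, e2]
        by_cases hne : z = z₀
        · subst hne
          rw [hw, tent_val (w := w) hσ hw0, tent_zero hσ, sub_zero]
          · rw [show k z - s z * (σ * w) - (k z + s z * σ) = s z * -(σ * w + σ) by ring, abs_mul,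
              hsabs, one_mul, abs_neg]
            exact (by linarith : σ ≤ σ * w + σ).trans (le_abs_self _)
          · rw [show k z + s z * (σ * w) - (k z + s z * σ) = s z * -(σ * (1 - w)) by ring, abs_mul,
              hsabs, one_mul, abs_neg, abs_of_nonneg]
            nlinarith
        · rw [hoth z hz hne]
          have h8 := hsep z₀ hz₀ z hz (Ne.symm hne)
          rw [tent_zero hσ, tent_zero hσ, sub_zero]
          · rcases hs z with h | h <;> rcases hs z₀ with h' | h' <;> rw [h, h'] <;>
              rcases le_abs.1 h8 with h9 | h9 <;> rw [le_abs] <;>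
              first | (left; linarith) | (right; linarith)
          · rcases hs z with h | h <;> rcases hs z₀ with h' | h' <;> rw [h, h'] <;>
              rcases le_abs.1 h8 with h9 | h9 <;> rw [le_abs] <;>
              first | (left; linarith) | (right; linarith)
  have eqgood : ∀ x, rho Z k σ (A (upd Z u pt t a P σ x)) = rho Z k σ (G (upd Z u pt t c Q (-σ) x)) ∧
      GoodPt (fun t => rho Z k σ (A t)) (fun t => rho Z k σ (G t)) (upd Z u pt t a P σ x)
        (upd Z u pt t c Q (-σ) x) := by
    intro x
    rcases upd_cases hC t x with ⟨y, hw, hy, hu⟩ |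
      ⟨z₀, hz₀, hzx, τ, w, hw0, hw1, hτ0, hτ1, hor, hoth, hw, hu⟩
    · rw [hu, hu]
      exact ⟨by rw [h.eq], (h.good y).comp (h.eq y) Z k hσ⟩
    · obtain ⟨h4, h5⟩ := hσt z₀ hz₀
      rw [hu _ _ _ (hP0 z₀), hu _ _ _ (hQ0 z₀)]
      by_cases hw00 : w = 0
      · subst hw00
        have h6 : 0 ≤ t z₀ * τ := by nlinarith
        have h7 : t z₀ * τ < δ z₀ := by nlinarith
        simp only [mul_zero, add_zero]
        have e : A (P z₀ (t z₀ * τ)) = G (Q z₀ (t z₀ * τ)) := by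
          rw [hAP _ _ h6 h7.le, hGQ _ _ h6 h7.le]
        exact ⟨by rw [e],
          (GoodPt.move (hs z₀) (hP z₀) (hQ z₀) (hAP z₀) (hGQ z₀) h6 h7).comp e Z k hσ⟩
      · have hτ : τ = 1 := hor.resolve_left hw00
        subst hτ
        have hwp : 0 < w := lt_of_le_of_ne hw0 (Ne.symm hw00)
        have hb : σ * w ≤ σ := by nlinarith
        have hb0 : 0 < σ * w := by positivity
        rw [mul_one, show t z₀ + -σ * w = t z₀ - σ * w by ring]
        exact GoodPt.tooth (hs z₀) (hP z₀) (hQ z₀) (hAP z₀) (hGQ z₀) Z k hσ hsep z₀ hz₀ (hkt z₀)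
          hb0 hb (by linarith) (by linarith)
  have closea := close a P σ (by rw [abs_of_pos hσ]) hda hP0 hPη
  have closec := close c Q (-σ) (by rw [abs_neg, abs_of_pos hσ]) hdc hQ0 hQη
  set a' := upd Z u pt t a P σ with ha'
  set c' := upd Z u pt t c Q (-σ) with hc'
  refine ⟨a', c', fun t => rho Z k σ (A t), fun t => rho Z k σ (G t),
    ⟨upd_cont hC t h.conta hP σ, upd_cont hC t h.contc hQ _, (rho_cont Z k σ).comp h.contA,
      (rho_cont Z k σ).comp h.contG, ?_, ?_, ?_, ?_, fun x => (eqgood x).1, fun x => (eqgood x).2⟩,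
    closea, closec, ?_⟩
  · intro t
    have h1 := abs_le.1 (rho_close Z k hσ (A t))
    rw [hN] at h1
    have h2 := abs_le.1 (h.hA t)
    rw [abs_le]; constructor <;> linarith
  · intro t
    have h1 := abs_le.1 (rho_close Z k hσ (G t))
    rw [hN] at h1
    have h2 := abs_le.1 (h.hG t)
    rw [abs_le]; constructor <;> linarith
  · intro x
    have h1 := abs_le.1 (closea x)
    have h2 := abs_le.1 (h.ha x)
    rw [abs_le]; constructor <;> linarith
  · intro x
    have h1 := abs_le.1 (closec x)
    have h2 := abs_le.1 (h.hc x)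
    rw [abs_le]; constructor <;> linarith
  -- robustness
  set ε' := ε / (2 * N + 1) with hε'
  have hε'0 : 0 < ε' := by positivity
  choose d hd0 hd using fun z => tent_unif h.contA h.hA hσ (k z + s z * σ) ε' hε'0
  choose d' hd'0 hd' using fun z => tent_unif h.contG h.hG hσ (k z + s z * σ) ε' hε'0
  obtain ⟨D, hD0, hD⟩ := exists_small Z (fun z => min (d z) (d' z))
    (fun z _ => lt_min (hd0 z) (hd'0 z))
  have hsepT : ∀ z ∈ Z, ∀ z' ∈ Z, ∀ r, tent σ (k z + s z * σ) r ≠ 0 →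
      tent σ (k z' + s z' * σ) r ≠ 0 → z = z' := by
    intro z hz z' hz' r h1 h2
    by_contra hne
    have h3 := abs_lt.1 (tent_ne hσ h1)
    have h4 := abs_lt.1 (tent_ne hσ h2)
    have h8 := hsep z hz z' hz' hne
    rcases hs z with h | h <;> rcases hs z' with h' | h' <;> rw [h] at h3 <;> rw [h'] at h4 <;>
      rcases le_abs.1 h8 with h9 | h9 <;> linarith
  have hsuppT : ∀ z ∈ Z, ∀ r t, |r - t| ≤ ρ → 1 ≤ |t - ‖pt z‖| →
      tent σ (k z + s z * σ) r = 0 := by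
    intro z hz r t' hr ht'
    by_contra hne
    have h3 := abs_lt.1 (tent_ne hσ hne)
    have h4 := abs_le.1 hr
    have h5 := abs_le.1 (h.hA (a (pt z)))
    have h6 := abs_le.1 (h.ha (pt z))
    have h7 := hkt z
    have h8 := hσt z hz
    have h9 := hδ8 z
    have h10 : κ z = A (a (pt z)) := rfl
    rw [← h10] at h5
    rcases hs z with h | h <;> rw [h] at h3 h7 <;> rcases le_abs.1 ht' with h11 | h11 <;> linarith
  refine ⟨D, hD0, fun a'' c'' haa hcc v M hM hv => ⟨fun r => ∑ z ∈ Z, v z * tent σ (k z + s z * σ) (A r),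
    fun r => ∑ z ∈ Z, (- v z) * tent σ (k z + s z * σ) (G r), ?_, ?_, ?_, ?_, ?_, ?_⟩⟩
  · have h1 := fun z => tent_cont σ (k z + s z * σ)
    have h2 := h.contA
    fun_prop
  · have h1 := fun z => tent_cont σ (k z + s z * σ)
    have h2 := h.contG
    fun_prop
  · intro r
    exact abs_sum_le_of_disj Z v _ M hM hv (fun z _ => tent_mem hσ)
      (fun z hz z' hz' => hsepT z hz z' hz' _)
  · intro r
    exact abs_sum_le_of_disj Z (fun z => - v z) _ M hM (fun z => by rw [abs_neg]; exact hv z)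
      (fun z _ => tent_mem hσ) (fun z hz z' hz' => hsepT z hz z' hz' _)
  · intro x
    have e : ∑ z ∈ Z, v z * tent σ (k z + s z * σ) (A (a'' x)) +
        ∑ z ∈ Z, (- v z) * tent σ (k z + s z * σ) (G (c'' x)) - ∑ z ∈ Z, v z * w2 (u z x) =
        ∑ z ∈ Z, v z * ((tent σ (k z + s z * σ) (A (a'' x)) - tent σ (k z + s z * σ) (A (a' x))) -
          (tent σ (k z + s z * σ) (G (c'' x)) - tent σ (k z + s z * σ) (G (c' x)))) := by
      rw [← Finset.sum_add_distrib, ← Finset.sum_sub_distrib]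
      apply Finset.sum_congr rfl
      intro z hz
      rw [← keyT x z hz]; ring
    beta_reduce
    rw [e]
    calc _ ≤ ∑ z ∈ Z, |v z * ((tent σ (k z + s z * σ) (A (a'' x)) - tent σ (k z + s z * σ) (A (a' x))) -
          (tent σ (k z + s z * σ) (G (c'' x)) - tent σ (k z + s z * σ) (G (c' x))))| :=
          Finset.abs_sum_le_sum_abs _ _
      _ ≤ ∑ z ∈ Z, M * (2 * ε') := by
          apply Finset.sum_le_sum
          intro z hz
          have hDz := le_min_iff.1 (hD z hz)
          rw [abs_mul]
          apply mul_le_mul (hv z) _ (abs_nonneg _) hM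
          have h1 := abs_le.1 (hd z _ _ ((haa x).trans hDz.1))
          have h2 := abs_le.1 (hd' z _ _ ((hcc x).trans hDz.2))
          rw [abs_le]; constructor <;> linarith
      _ = M * (2 * N * ε') := by rw [Finset.sum_const, nsmul_eq_mul, hN]; ring
      _ ≤ ε * M := by
          have : 2 * N * ε' ≤ ε := by
            have : (2 * N + 1) * ε' = ε := by rw [hε']; field_simp
            linarith
          nlinarith
  · intro t' ht'
    constructor
    · apply Finset.sum_eq_zero
      intro z hz
      by_cases hv0 : v z = 0
      · rw [hv0]; simp
      · rw [hsuppT z hz _ t' (h.hA t') (ht' z hz hv0), mul_zero]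
    · apply Finset.sum_eq_zero
      intro z hz
      by_cases hv0 : v z = 0
      · rw [hv0]; simp
      · rw [hsuppT z hz _ t' (h.hG t') (ht' z hz hv0), mul_zero]

end KST

namespace KST

open Set

noncomputable def bmp (m : ℕ) (y : ℝ) : ℝ := max 0 (min 1 (2 * (m + 1) * min y (1 - y)))

noncomputable def off (m p : ℕ) : ℝ := p / (m + 1)

noncomputable def cu (m p K : ℕ) (z : Fin m → ℤ) (x : Fin m → ℝ) : ℝ :=
  ∏ i, bmp m (K * x i - off m p - z i)

noncomputable def cpt (m p K : ℕ) (z : Fin m → ℤ) : Fin m → ℝ :=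
  fun i => (z i + 1 / 2 + off m p) / K

noncomputable def zset (m K R : ℕ) : Finset (Fin m → ℤ) :=
  Fintype.piFinset fun _ => Finset.Icc (-((K * R + 2 : ℕ) : ℤ)) ((K * R + 2 : ℕ) : ℤ)

lemma bmp_cont (m : ℕ) : Continuous (bmp m) := by unfold bmp; fun_prop

lemma bmp_nonneg (m : ℕ) (y : ℝ) : 0 ≤ bmp m y := le_max_left _ _

lemma bmp_le (m : ℕ) (y : ℝ) : bmp m y ≤ 1 := max_le zero_le_one (min_le_left _ _)

lemma bmp_ne {m : ℕ} {y : ℝ} (h : bmp m y ≠ 0) : 0 < y ∧ y < 1 := by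
  by_contra hc
  apply h
  have : min y (1 - y) ≤ 0 := by
    by_contra h1
    rw [not_le, lt_min_iff] at h1
    exact hc ⟨h1.1, by linarith [h1.2]⟩
  refine max_eq_left ((min_le_right _ _).trans ?_)
  exact mul_nonpos_of_nonneg_of_nonpos (by positivity) this

lemma bmp_one {m : ℕ} {y : ℝ} (h : 1 / (2 * (m + 1 : ℝ)) ≤ y) (h' : y ≤ 1 - 1 / (2 * (m + 1 : ℝ))) :
    bmp m y = 1 := by
  have h0 : 0 < 2 * (m + 1 : ℝ) := by positivity
  have : 1 / (2 * (m + 1 : ℝ)) ≤ min y (1 - y) := le_min h (by linarith)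
  have h2 : 1 ≤ 2 * (m + 1) * min y (1 - y) := by
    rw [div_le_iff₀ h0] at this; linarith
  unfold bmp
  rw [min_eq_left h2, max_eq_right zero_le_one]

lemma off_nonneg (m p : ℕ) : 0 ≤ off m p := by unfold off; positivity

lemma off_le {m p : ℕ} (h : p ≤ m) : off m p ≤ 1 := by
  unfold off
  rw [div_le_one (by positivity)]
  have : (p : ℝ) ≤ m := by exact_mod_cast h
  linarith

lemma cu_ne {m p K : ℕ} {z : Fin m → ℤ} {x : Fin m → ℝ} (h : cu m p K z x ≠ 0) (i : Fin m) :
    (z i : ℝ) < K * x i - off m p ∧ K * x i - off m p < z i + 1 := by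
  have := bmp_ne (Finset.prod_ne_zero_iff.1 h i (Finset.mem_univ i))
  constructor <;> linarith [this.1, this.2]

lemma cells (m p K : ℕ) (hK : 0 < K) (Z : Finset (Fin m → ℤ)) :
    Cells Z (cu m p K) (cpt m p K) where
  cont z := by
    unfold cu
    have := bmp_cont m
    fun_prop
  nonneg z x := Finset.prod_nonneg fun i _ => bmp_nonneg _ _
  le_one z x := Finset.prod_le_one (fun i _ => bmp_nonneg _ _) (fun i _ => bmp_le _ _)
  disj z z' x h h' := by
    ext i
    have h1 := cu_ne h i
    have h2 := cu_ne h' i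
    have h3 : (z i : ℝ) < z' i + 1 := by linarith
    have h4 : (z' i : ℝ) < z i + 1 := by linarith
    have h5 : z i < z' i + 1 := by exact_mod_cast h3
    have h6 : z' i < z i + 1 := by exact_mod_cast h4
    omega
  pt_one z := by
    apply Finset.prod_eq_one
    intro i _
    have hK' : (K : ℝ) ≠ 0 := by positivity
    have e : (K : ℝ) * cpt m p K z i - off m p - z i = 1 / 2 := by
      unfold cpt; field_simp; ring
    rw [e]
    have : 1 / (2 * (m + 1 : ℝ)) ≤ 1 / 2 := by
      apply one_div_le_one_div_of_le (by norm_num)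
      have : (0 : ℝ) ≤ m := by positivity
      linarith
    apply bmp_one <;> linarith

lemma cu_close {m p K : ℕ} (hK : 0 < K) {z : Fin m → ℤ} {x : Fin m → ℝ} (h : cu m p K z x ≠ 0) :
    ‖x - cpt m p K z‖ ≤ 1 / K := by
  have hK' : (0 : ℝ) < K := by positivity
  rw [pi_norm_le_iff_of_nonneg (by positivity)]
  intro i
  have h1 := cu_ne h i
  rw [Pi.sub_apply, Real.norm_eq_abs]
  have e : x i - cpt m p K z i = (K * x i - off m p - z i - 1 / 2) / K := by
    unfold cpt; field_simp; ring
  rw [e, abs_div, abs_of_pos hK']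
  apply div_le_div_of_nonneg_right _ hK'.le
  rw [abs_le]; constructor <;> linarith

lemma cu_mem {m p K R : ℕ} (hp : p ≤ m) {z : Fin m → ℤ} {x : Fin m → ℝ} (h : cu m p K z x ≠ 0)
    (hx : ‖x‖ ≤ R) : z ∈ zset m K R := by
  unfold zset
  rw [Fintype.mem_piFinset]
  intro i
  have h1 := cu_ne h i
  have h2 := abs_le.1 ((norm_le_pi_norm x i).trans hx)
  have h3 := off_nonneg m p
  have h4 := off_le hp
  have hK' : (0 : ℝ) ≤ K := by positivity
  have h5 : (K : ℝ) * x i ≤ K * R := by nlinarith [h2.2]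
  have h6 : -((K : ℝ) * R) ≤ K * x i := by nlinarith [h2.1]
  rw [Finset.mem_Icc]
  constructor
  · have : (-((K * R + 2 : ℕ) : ℤ) : ℝ) ≤ z i := by push_cast; linarith
    exact_mod_cast this
  · have : (z i : ℝ) ≤ ((K * R + 2 : ℕ) : ℤ) := by push_cast; linarith
    exact_mod_cast this

lemma cu_bdd {m p K R : ℕ} (hK : 0 < K) (hp : p ≤ m) {z : Fin m → ℤ} (hz : z ∈ zset m K R) :
    ‖cpt m p K z‖ ≤ R + 4 := by
  have hK' : (0 : ℝ) < K := by positivity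
  have hK1 : (1 : ℝ) ≤ K := by exact_mod_cast hK
  rw [pi_norm_le_iff_of_nonneg (by positivity)]
  intro i
  unfold zset at hz
  rw [Fintype.mem_piFinset] at hz
  have h1 := Finset.mem_Icc.1 (hz i)
  have h3 := off_nonneg m p
  have h4 := off_le hp
  have h5 : (-((K * R + 2 : ℕ) : ℤ) : ℝ) ≤ z i := by exact_mod_cast h1.1
  have h6 : (z i : ℝ) ≤ ((K * R + 2 : ℕ) : ℤ) := by exact_mod_cast h1.2
  push_cast at h5 h6
  unfold cpt
  rw [Real.norm_eq_abs, abs_div, abs_of_pos hK', div_le_iff₀ hK', abs_le]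
  constructor <;> nlinarith

lemma cover {m : ℕ} (K : ℕ) (x : Fin m → ℝ) : ∃ p ≤ m, ∃ z, cu m p K z x = 1 := by
  by_contra hc
  push Not at hc
  have hβ : (0 : ℝ) < 2 * (m + 1 : ℝ) := by positivity
  have bad : ∀ p : Fin (m + 1), ∃ i : Fin m, ∃ n : ℤ,
      |K * x i - off m p - n| < 1 / (2 * (m + 1 : ℝ)) := by
    intro p
    by_contra hg
    push Not at hg
    apply hc p (Nat.lt_succ_iff.1 p.2) (fun i => ⌊K * x i - off m p⌋)
    apply Finset.prod_eq_one
    intro i _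
    have h1 := hg i ⌊K * x i - off m p⌋
    have h2 := hg i (⌊K * x i - off m p⌋ + 1)
    have h3 := Int.floor_le (K * x i - off m p)
    have h4 := Int.lt_floor_add_one (K * x i - off m p)
    rw [abs_of_nonneg (by linarith)] at h1
    push_cast at h2
    rw [abs_of_nonpos (by linarith)] at h2
    apply bmp_one <;> linarith
  choose b n hb using bad
  have hinj : Function.Injective b := by
    intro p q hpq
    have h1 := abs_lt.1 (hb p)
    have h2 := abs_lt.1 (hb q)
    rw [← hpq] at h2
    have hm : (0 : ℝ) < m + 1 := by positivity
    have e : (1 : ℝ) / (2 * (m + 1 : ℝ)) + 1 / (2 * (m + 1 : ℝ)) = 1 / (m + 1) := by field_simp; norm_num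
    have h3 : |off m p - off m q + n p - n q| < 1 / (m + 1) := by
      rw [abs_lt]; constructor <;> linarith [h1.1, h1.2, h2.1, h2.2]
    have e2 : off m p - off m q + n p - n q =
        (((p : ℤ) - (q : ℤ) + (m + 1) * (n p - n q) : ℤ) : ℝ) / (m + 1) := by
      unfold off; push_cast; field_simp; ring
    rw [e2, abs_div, abs_of_pos hm, div_lt_div_iff_of_pos_right hm] at h3
    have h4 : |(p : ℤ) - (q : ℤ) + (m + 1) * (n p - n q)| < 1 := by exact_mod_cast h3
    rw [Int.abs_lt_one_iff] at h4
    have hp := p.2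
    have hq := q.2
    ext
    have h5 : ((m : ℤ) + 1) ∣ (p : ℤ) - (q : ℤ) := ⟨-(n p - n q), by linarith⟩
    have h6 : (p : ℤ) - (q : ℤ) = 0 := by
      apply Int.eq_zero_of_abs_lt_dvd h5
      rw [abs_lt]; constructor <;> omega
    omega
  have := Fintype.card_le_of_injective b hinj
  simp at this

lemma hcell0 {m K : ℕ} (hm : 1 ≤ m) (hK : 0 < K) {z : Fin m → ℤ} {x y : Fin m → ℝ}
    (hx : cu m 0 K z x ≠ 0) (hy : cu m 0 K z y ≠ 0) (j : ℤ) (hj : ‖x‖ ≤ j) : ‖y‖ < j := by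
  have hK' : (0 : ℝ) < K := by positivity
  have key : ∀ i, |y i| < j := by
    intro i
    have h1 := cu_ne hx i
    have h2 := cu_ne hy i
    have h3 := abs_le.1 ((norm_le_pi_norm x i).trans hj)
    have h0 : off m 0 = 0 := by unfold off; simp
    rw [h0, sub_zero] at h1 h2
    have h4 : (z i : ℝ) < ((K * j : ℤ) : ℝ) := by push_cast; nlinarith [h3.2]
    have h5 : ((-(K * j) : ℤ) : ℝ) < ((z i + 1 : ℤ) : ℝ) := by push_cast; nlinarith [h3.1]
    have h4' : z i + 1 ≤ K * j := by
      have : z i < K * j := by exact_mod_cast h4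
      omega
    have h5' : -(K * j : ℤ) ≤ z i := by
      have : -(K * j : ℤ) < z i + 1 := by exact_mod_cast h5
      omega
    have h6 : ((z i + 1 : ℤ) : ℝ) ≤ ((K * j : ℤ) : ℝ) := by exact_mod_cast h4'
    have h7 : ((-(K * j) : ℤ) : ℝ) ≤ z i := by exact_mod_cast h5'
    push_cast at h6 h7
    rw [abs_lt]
    constructor
    · by_contra hc
      push Not at hc
      nlinarith
    · by_contra hc
      push Not at hc
      nlinarith
  rw [pi_norm_lt_iff ((abs_nonneg _).trans_lt (key ⟨0, hm⟩))]
  exact key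

lemma diam_lemma {m : ℕ} (φ : (Fin m → ℝ) → ℝ) (hφ : Continuous φ) (R : ℕ) {η : ℝ} (hη : 0 < η) :
    ∃ K₀ : ℕ, ∀ K, K₀ ≤ K → 0 < K → ∀ p ≤ m, ∀ z ∈ zset m K R, ∀ x y, cu m p K z x ≠ 0 →
      ‖y - cpt m p K z‖ ≤ ‖x - cpt m p K z‖ → |φ y - φ (cpt m p K z)| ≤ η := by
  have hu := (isCompact_closedBall (0 : Fin m → ℝ) (R + 5)).uniformContinuousOn_of_continuous
    hφ.continuousOn
  obtain ⟨δ, hδ, h⟩ := Metric.uniformContinuousOn_iff.1 hu η hη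
  obtain ⟨K₀, hK₀⟩ := exists_nat_one_div_lt hδ
  refine ⟨K₀ + 1, fun K hK hK0 p hp z hz x y hx hy => ?_⟩
  have hK' : (0 : ℝ) < K := by positivity
  have h1 := cu_close hK0 hx
  have h2 := cu_bdd hK0 hp hz
  have hK1 : (1 : ℝ) ≤ K := by exact_mod_cast hK0
  have h3 : 1 / (K : ℝ) ≤ 1 := by rw [div_le_one hK']; exact hK1
  have h4 : 1 / (K : ℝ) < δ := by
    refine lt_of_le_of_lt (one_div_le_one_div_of_le (by positivity) ?_) hK₀
    exact_mod_cast hK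
  have h5 : ‖y‖ ≤ R + 5 := by
    have := norm_add_le (y - cpt m p K z) (cpt m p K z)
    rw [sub_add_cancel] at this
    linarith
  have := h y (by simpa using h5) (cpt m p K z) (by simp; linarith) (by
    rw [dist_eq_norm]; linarith)
  exact this.le

end KST

namespace KST

open Set Filter Topology

lemma baire_lemma {M : Type*} [MetricSpace M] [CompleteSpace M] (T : Set M) (hT : T.Nonempty)
    (S : ℕ → Set M)
    (hd : ∀ x ∈ T, ∀ ε > 0, ∀ k, ∃ y ∈ T, dist y x < ε ∧ ∃ δ > 0, Metric.ball y δ ⊆ S k) :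
    ∃ x ∈ closure T, ∀ k, x ∈ S k := by
  have hcl : IsClosed (closure T) := isClosed_closure
  have : CompleteSpace (closure T) := hcl.completeSpace_coe
  have : Nonempty (closure T) := hT.closure.to_subtype
  have hdense : Dense (⋂ k, ((fun x : closure T => (x : M)) ⁻¹' interior (S k))) := by
    apply dense_iInter_of_isOpen_nat
    · intro k
      exact isOpen_interior.preimage continuous_subtype_val
    · intro k
      rw [Metric.dense_iff]
      rintro ⟨x, hx⟩ r hr
      obtain ⟨x', hx', hxx'⟩ := Metric.mem_closure_iff.1 hx (r / 2) (by positivity)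
      obtain ⟨y, hy, hyx, δ, hδ, hb⟩ := hd x' hx' (r / 2) (by positivity) k
      refine ⟨⟨y, subset_closure hy⟩, ?_, ?_⟩
      · rw [Metric.mem_ball, Subtype.dist_eq]
        have h1 := dist_triangle y x' x
        have h2 := dist_comm x x'
        show dist y x < r
        linarith
      · exact mem_interior.2 ⟨_, hb, Metric.isOpen_ball, Metric.mem_ball_self hδ⟩
  obtain ⟨x, hx⟩ := hdense.nonempty
  refine ⟨x, x.2, fun k => ?_⟩
  exact interior_subset (Set.mem_iInter.1 hx k)

open scoped BoundedContinuousFunction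

variable {X : Type*} [NormedAddCommGroup X]

def toF (b : X →ᵇ ℝ) (x : X) : ℝ := ‖x‖ + b x

lemma toF_cont (b : X →ᵇ ℝ) : Continuous (toF b) := by
  unfold toF
  have := b.continuous
  fun_prop

lemma toF_sub (b b' : X →ᵇ ℝ) (x : X) : |toF b x - toF b' x| ≤ dist b b' := by
  have := BoundedContinuousFunction.dist_coe_le_dist (f := b) (g := b') x
  rw [Real.dist_eq] at this
  unfold toF
  rwa [add_sub_add_left_eq_sub]

lemma exists_bcf (b : X →ᵇ ℝ) (φ : X → ℝ) (hφ : Continuous φ) (C : ℝ) (hC : 0 ≤ C)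
    (h : ∀ x, |φ x - toF b x| ≤ C) : ∃ b' : X →ᵇ ℝ, toF b' = φ ∧ dist b' b ≤ C := by
  have hb := toF_cont b
  refine ⟨b + BoundedContinuousFunction.ofNormedAddCommGroup (fun x => φ x - toF b x)
    (by fun_prop) C h, ?_, ?_⟩
  · funext x
    simp only [toF, BoundedContinuousFunction.coe_add, Pi.add_apply, BoundedContinuousFunction.coe_ofNormedAddCommGroup]
    ring
  · rw [BoundedContinuousFunction.dist_le hC]
    intro x
    rw [Real.dist_eq]
    simpa using h x

lemma goodId (α : ℝ) : GoodPt (fun t => t) (fun t => t) α α := by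
  intro η hη
  refine ⟨η, hη, fun t => α + t, fun t => α + t, 1, Or.inl rfl, by fun_prop, by fun_prop, by simp,
    by simp, fun t h0 h1 => ?_⟩
  simp [abs_of_nonneg h0, h1]

def PropAll (m k : ℕ) (φ : (Fin m → ℝ) → ℝ) (a c : Fin m → (Fin m → ℝ) → ℝ) : Prop :=
  ∃ K, k < K ∧ PropS (zset m K k) (cu m 0 K) (cpt m 0 K) φ ∧
    ∀ p : Fin m, PropP (zset m K k) (cu m (p + 1) K) (cpt m (p + 1) K) (1 / (k + 1)) (a p) (c p)

lemma exists_family (m : ℕ) (hm : 1 ≤ m) :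
    ∃ (φ : (Fin m → ℝ) → ℝ) (a c : Fin m → (Fin m → ℝ) → ℝ), Continuous φ ∧
      (∀ p, Continuous (a p)) ∧ (∀ p, Continuous (c p)) ∧ Wall φ ∧ ∀ k, PropAll m k φ a c := by
  let X := Fin m → ℝ
  let M := (X →ᵇ ℝ) × (Fin m → (X →ᵇ ℝ)) × (Fin m → (X →ᵇ ℝ))
  let T : Set M := {b | Wall (toF b.1) ∧ ∀ p, ∃ ρ < 1 / 8, ∃ A G,
    TP ρ (toF (b.2.1 p)) (toF (b.2.2 p)) A G}
  let S : ℕ → Set M := fun k => {b | PropAll m k (toF b.1) (fun p => toF (b.2.1 p))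
    (fun p => toF (b.2.2 p))}
  have key : ∃ x ∈ closure T, ∀ k, x ∈ S k := by
    apply baire_lemma
    · refine ⟨0, ?_, fun p => ⟨0, by norm_num, fun t => t, fun t => t, ?_⟩⟩
      · intro x j
        have : toF (0 : X →ᵇ ℝ) x = ‖x‖ := by simp [toF]
        show (_ → toF (0 : X →ᵇ ℝ) x ≤ j) ∧ (_ → (j : ℝ) ≤ toF (0 : X →ᵇ ℝ) x)
        rw [this]
        exact ⟨id, id⟩
      · have e : ∀ x, toF (0 : X →ᵇ ℝ) x = ‖x‖ := fun x => by simp [toF]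
        show TP 0 (toF (0 : X →ᵇ ℝ)) (toF (0 : X →ᵇ ℝ)) _ _
        exact ⟨toF_cont _, toF_cont _, continuous_id, continuous_id, by simp, by simp,
          by simp [e], by simp [e], fun x => rfl, fun x => goodId _⟩
    · rintro ⟨b0, ba, bc⟩ ⟨hW, hTP⟩ ε hε k
      simp only at hW hTP
      choose ρ hρ A G hTP using hTP
      obtain ⟨η₁, hη₁, hη₁'⟩ := exists_small Finset.univ (fun p => (1 / 8 - ρ p) / 4)
        (fun p _ => by have := hρ p; linarith)
      set η := min η₁ (ε / 8) with hη
      have hη0 : 0 < η := by positivity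
      have hηε : 3 * η < ε := by have := min_le_right η₁ (ε / 8); linarith
      have hηρ : ∀ p, ρ p + 3 * η < 1 / 8 := fun p => by
        have h1 := hη₁' p (Finset.mem_univ p)
        have h2 := min_le_left η₁ (ε / 8)
        have := hρ p
        linarith
      have hdiam : ∀ b : X →ᵇ ℝ, ∀ᶠ K : ℕ in atTop, ∀ p ≤ m, ∀ z ∈ zset m K k, ∀ x y,
          cu m p K z x ≠ 0 → ‖y - cpt m p K z‖ ≤ ‖x - cpt m p K z‖ →
          |toF b y - toF b (cpt m p K z)| ≤ η := by
        intro b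
        obtain ⟨K₀, hK₀⟩ := diam_lemma (toF b) (toF_cont b) k hη0
        filter_upwards [eventually_ge_atTop K₀, eventually_gt_atTop 0] with K h1 h2
        exact hK₀ K h1 h2
      obtain ⟨K, ⟨⟨hK0, hKa⟩, hKc⟩, hKk⟩ := ((((hdiam b0).and
        (eventually_all.2 fun p => hdiam (ba p))).and
        (eventually_all.2 fun p => hdiam (bc p))).and (eventually_gt_atTop k)).exists
      have hKpos : 0 < K := by omega
      obtain ⟨φ', hφ'c, hφ'W, hφ'd, δ, hδ, hS⟩ := stepS (zset m K k) (cu m 0 K) (cpt m 0 K)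
        (cells m 0 K hKpos _) (toF b0) (toF_cont b0) hW η hη0
        (fun z hz x hx => hK0 0 (Nat.zero_le _) z hz x x hx le_rfl)
        (fun z hz x y hx hy j hj => hcell0 hm hKpos hx hy j hj)
      have hP := fun p : Fin m => stepP (cells m (p + 1) K hKpos (zset m K k)) (hTP p) hη0 (hηρ p)
        (ε := 1 / (k + 1)) (by positivity)
        (fun z hz x y => hKa p (p + 1) p.2 z hz x y) (fun z hz x y => hKc p (p + 1) p.2 z hz x y)
      choose a' c' A' G' hTP' ha' hc' δ' hδ' hP' using hP
      obtain ⟨b0', hb0', hb0d⟩ := exists_bcf b0 φ' hφ'c (2 * η) (by positivity) hφ'd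
      have hba := fun p => exists_bcf (ba p) (a' p) (hTP' p).conta (3 * η) (by positivity) (ha' p)
      have hbc := fun p => exists_bcf (bc p) (c' p) (hTP' p).contc (3 * η) (by positivity) (hc' p)
      choose ba' hba' hbad using hba
      choose bc' hbc' hbcd using hbc
      obtain ⟨D, hD0, hD⟩ := exists_small Finset.univ δ' (fun p _ => hδ' p)
      refine ⟨(b0', ba', bc'), ⟨?_, fun p => ⟨ρ p + 3 * η, hηρ p, A' p, G' p, ?_⟩⟩, ?_, min δ D,
        lt_min hδ hD0, ?_⟩
      · simp only [hb0']; exact hφ'W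
      · simp only [hba', hbc']; exact hTP' p
      · rw [Prod.dist_eq, max_lt_iff, Prod.dist_eq, max_lt_iff]
        refine ⟨by simp only; linarith, ?_, ?_⟩
        · rw [dist_pi_lt_iff hε]
          intro p; have := hbad p; simp only; linarith
        · rw [dist_pi_lt_iff hε]
          intro p; have := hbcd p; simp only; linarith
      · rintro ⟨e0, ea, ec⟩ he
        rw [Metric.mem_ball, Prod.dist_eq, max_lt_iff, Prod.dist_eq, max_lt_iff, lt_min_iff] at he
        obtain ⟨⟨h0, -⟩, h1, h2⟩ := he
        rw [dist_pi_lt_iff (lt_min hδ hD0)] at h1 h2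
        simp only at h0 h1 h2
        refine ⟨K, hKk, hS _ fun x => ?_, fun p => hP' p _ _ (fun x => ?_) fun x => ?_⟩
        · rw [← hb0']; exact (toF_sub _ _ _).trans h0.le
        · rw [← hba' p]
          exact (toF_sub _ _ _).trans ((h1 p).le.trans ((min_le_right _ _).trans
            (hD p (Finset.mem_univ p))))
        · rw [← hbc' p]
          exact (toF_sub _ _ _).trans ((h2 p).le.trans ((min_le_right _ _).trans
            (hD p (Finset.mem_univ p))))
  obtain ⟨b, hb, hk⟩ := key
  refine ⟨toF b.1, fun p => toF (b.2.1 p), fun p => toF (b.2.2 p), toF_cont _, fun p => toF_cont _,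
    fun p => toF_cont _, ?_, hk⟩
  intro x j
  have hclose : ∀ ε > 0, ∃ b' : X →ᵇ ℝ, Wall (toF b') ∧ |toF b.1 x - toF b' x| ≤ ε := by
    intro ε hε
    obtain ⟨b', hb', hd⟩ := Metric.mem_closure_iff.1 hb ε hε
    refine ⟨b'.1, hb'.1, (toF_sub _ _ _).trans ?_⟩
    rw [Prod.dist_eq] at hd
    exact (le_max_left _ _).trans hd.le
  constructor
  · intro hj
    apply le_of_forall_pos_le_add
    intro ε hε
    obtain ⟨b', hW, hd⟩ := hclose ε hε
    have h1 := (hW x j).1 hj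
    have h2 := abs_le.1 hd
    linarith
  · intro hj
    apply le_of_forall_pos_le_add
    intro ε hε
    obtain ⟨b', hW, hd⟩ := hclose ε hε
    have h1 := (hW x j).2 hj
    have h2 := abs_le.1 hd
    linarith

end KST

namespace KST

open Set Filter Topology

def OneStep {m : ℕ} {I : Type*} [Fintype I] (Φ : I → (Fin m → ℝ) → ℝ) (θ : ℝ) : Prop :=
  ∀ f : (Fin m → ℝ) → ℝ, Continuous f → ∀ n : ℕ, (∀ x, 1 ≤ |‖x‖ - n| → f x = 0) →
    ∀ M, 0 ≤ M → (∀ x, |f x| ≤ M) → ∀ ε > 0, ∃ g : I → ℝ → ℝ, (∀ i, Continuous (g i)) ∧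
      (∀ i t, |g i t| ≤ M) ∧ (∀ i (t : ℝ), 3 ≤ |t - n| → g i t = 0) ∧
      (∀ x, |f x - ∑ i, g i (Φ i x)| ≤ θ * M + ε) ∧
      (∀ x, 1 ≤ |‖x‖ - n| → |f x - ∑ i, g i (Φ i x)| ≤ ε)

lemma w2_mem {u : ℝ} (h1 : u ≤ 1) : 0 ≤ w2 u ∧ w2 u ≤ 1 :=
  ⟨le_max_left _ _, max_le zero_le_one (by linarith)⟩

lemma pair_sum {X ι : Type*} [NormedAddCommGroup X] {Z : Finset ι} {u : ι → X → ℝ} {pt : ι → X}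
    (hC : Cells Z u pt) (f : X → ℝ) (x : X) {lam ε : ℝ} (hl : 0 ≤ lam) (hε : 0 ≤ ε)
    (h : ∀ z ∈ Z, u z x ≠ 0 → |f (pt z) - f x| ≤ ε) :
    ∃ ω : ℝ, 0 ≤ ω ∧ ω ≤ 1 ∧ ((∃ z ∈ Z, u z x = 1) → ω = 1) ∧
      |∑ z ∈ Z, lam * f (pt z) * w2 (u z x) - lam * ω * f x| ≤ lam * ε := by
  by_cases hz : ∃ z ∈ Z, u z x ≠ 0
  · obtain ⟨z, hz, hzx⟩ := hz
    obtain ⟨h0, h1⟩ := w2_mem (hC.le_one z x)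
    refine ⟨w2 (u z x), h0, h1, ?_, ?_⟩
    · rintro ⟨z', hz', hz'x⟩
      have : z' = z := hC.disj _ _ _ (by rw [hz'x]; exact one_ne_zero) hzx
      rw [← this, hz'x]; unfold w2; norm_num
    · rw [sum_single Z (fun z => lam * f (pt z) * w2 (u z x)) z hz (fun z' _ hne => by
        by_cases h0 : u z' x = 0
        · simp [h0, w2_zero]
        · exact absurd (hC.disj _ _ _ h0 hzx) hne)]
      rw [show lam * f (pt z) * w2 (u z x) - lam * w2 (u z x) * f x =
        lam * (w2 (u z x) * (f (pt z) - f x)) by ring, abs_mul, abs_of_nonneg hl, abs_mul,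
        abs_of_nonneg h0]
      apply mul_le_mul_of_nonneg_left _ hl
      have := h z hz hzx
      nlinarith [abs_nonneg (f (pt z) - f x)]
  · push Not at hz
    refine ⟨0, le_rfl, zero_le_one, ?_, ?_⟩
    · rintro ⟨z', hz', hz'x⟩
      rw [hz z' hz'] at hz'x
      norm_num at hz'x
    · rw [Finset.sum_eq_zero (fun z hz' => by rw [hz z hz', w2_zero, mul_zero])]
      simp; positivity

def fam {m : ℕ} (φ : (Fin m → ℝ) → ℝ) (a c : Fin m → (Fin m → ℝ) → ℝ) :
    Option (Fin m ⊕ Fin m) → (Fin m → ℝ) → ℝ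
  | none => φ
  | some (Sum.inl p) => a p
  | some (Sum.inr p) => c p

def famg {m : ℕ} (φ : ℝ → ℝ) (a c : Fin m → ℝ → ℝ) :
    Option (Fin m ⊕ Fin m) → ℝ → ℝ
  | none => φ
  | some (Sum.inl p) => a p
  | some (Sum.inr p) => c p

lemma fam_forall {m : ℕ} {Q : Option (Fin m ⊕ Fin m) → Prop} (h0 : Q none)
    (h1 : ∀ p, Q (some (Sum.inl p))) (h2 : ∀ p, Q (some (Sum.inr p))) : ∀ i, Q i := by
  rintro (_ | p | p)
  · exact h0
  · exact h1 p
  · exact h2 p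

lemma final_est {L lam M F W g0 E0 E ε : ℝ} (hL : 0 ≤ L) (hlam : lam = 2 * L)
    (hF : |F| ≤ M)
    (hW0 : 0 ≤ W) (hW : W ≤ 1 - L) (hE : |E| ≤ ε - E0) (hg0 : |g0| ≤ L * M) (hE0 : 0 ≤ E0)
    (hor : |g0 - L * F| ≤ E0 ∨ lam ≤ W) : |F - (g0 + (W * F + E))| ≤ (1 - L) * M + ε := by
  have hF' := abs_le.1 hF
  have hE' := abs_le.1 hE
  have hg0' := abs_le.1 hg0
  rcases hor with h | h
  · have h' := abs_le.1 h
    have h1 : |(1 - L - W) * F| ≤ (1 - L) * M := by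
      rw [abs_mul, abs_of_nonneg (by linarith)]
      apply mul_le_mul (by linarith) hF (abs_nonneg _) (by linarith)
    have h1' := abs_le.1 h1
    rw [abs_le]; constructor <;> linarith
  · have h1 : |(1 - W) * F| ≤ (1 - lam) * M := by
      rw [abs_mul, abs_of_nonneg (by linarith)]
      apply mul_le_mul (by linarith) hF (abs_nonneg _) (by linarith)
    have h1' := abs_le.1 h1
    subst hlam
    rw [abs_le]; constructor <;> linarith

lemma oneStep {m : ℕ} {φ : (Fin m → ℝ) → ℝ} {a c : Fin m → (Fin m → ℝ) → ℝ}
    (hW : Wall φ) (hk : ∀ k, PropAll m k φ a c) :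
    OneStep (fam φ a c) (1 - 1 / (2 * m + 1)) := by
  intro f hf n hsupp M hM hfM ε hε
  set L : ℝ := 1 / (2 * m + 1) with hLdef
  have hL : 0 < L := by positivity
  have hmL : (m : ℝ) * (2 * L) = 1 - L := by rw [hLdef]; field_simp; ring
  have hL1 : L ≤ 1 := by
    have : (0 : ℝ) ≤ m * (2 * L) := by positivity
    linarith
  have hcs : HasCompactSupport f := by
    apply HasCompactSupport.intro (isCompact_closedBall (0 : Fin m → ℝ) (n + 1))
    intro x hx
    apply hsupp
    rw [mem_closedBall_zero_iff, not_le] at hx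
    rw [le_abs]; left; linarith
  have hu : UniformContinuous f := hcs.uniformContinuous_of_continuous hf
  obtain ⟨δ, hδ, hfδ⟩ := Metric.uniformContinuous_iff.1 hu (ε / 2) (by positivity)
  obtain ⟨k1, hk1⟩ := exists_nat_one_div_lt hδ
  obtain ⟨k2, hk2⟩ := exists_nat_one_div_lt (show 0 < ε / (2 * (M + 1)) by positivity)
  set k := max (max k1 k2) (n + 1) with hkdef
  have hkk1 : k1 ≤ k := (le_max_left _ _).trans (le_max_left _ _)
  have hkk2 : k2 ≤ k := (le_max_right _ _).trans (le_max_left _ _)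
  have hkn : n + 1 ≤ k := le_max_right _ _
  obtain ⟨K, hkK, hS, hP⟩ := hk k
  have hK0 : 0 < K := by omega
  have hKδ : 1 / (K : ℝ) < δ := by
    refine lt_of_le_of_lt (one_div_le_one_div_of_le (by positivity) ?_) hk1
    have : k1 + 1 ≤ K := by omega
    exact_mod_cast this
  set εk : ℝ := 1 / (k + 1) with hεk
  have hεk0 : 0 < εk := by positivity
  have hεkM : εk * M ≤ ε / 2 := by
    have h1 : εk ≤ ε / (2 * (M + 1)) := by
      refine le_trans (one_div_le_one_div_of_le (by positivity) ?_) hk2.le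
      have : (k2 : ℝ) ≤ k := by exact_mod_cast hkk2
      linarith
    calc εk * M ≤ ε / (2 * (M + 1)) * (M + 1) := mul_le_mul h1 (by linarith) hM (by positivity)
      _ = ε / 2 := by field_simp
  have hnear : ∀ p z x, cu m p K z x ≠ 0 → |f (cpt m p K z) - f x| ≤ ε / 2 := by
    intro p z x hx
    have h1 := cu_close hK0 hx
    have := hfδ (a := cpt m p K z) (b := x) (by rw [dist_comm, dist_eq_norm]; linarith)
    exact this.le
  have hne : ∀ {lam : ℝ} {x}, lam * f x ≠ 0 → |‖x‖ - n| < 1 := by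
    intro lam x h
    by_contra hc
    exact h (by rw [hsupp x (not_lt.1 hc), mul_zero])
  have hbd : ∀ {lam : ℝ}, 0 ≤ lam → ∀ x, |lam * f x| ≤ lam * M := by
    intro lam hl x
    rw [abs_mul, abs_of_nonneg hl]
    exact mul_le_mul_of_nonneg_left (hfM x) hl
  obtain ⟨g0, hg0c, hg0b, hg0v, hg0s⟩ := hS (fun z => L * f (cpt m 0 K z)) (L * M) (by positivity)
    (fun z => hbd hL.le _)
  have hpair := fun p : Fin m => hP p (fun z => 2 * L * f (cpt m (p + 1) K z)) (2 * L * M)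
    (by positivity) (fun z => hbd (by positivity) _)
  choose ga gc hgac hgcc hgab hgcb hgab2 hgs using hpair
  have hs0 := hg0s ((n : ℤ) - 1) ((n : ℤ) + 1) (by
    intro z hz hv
    have := abs_lt.1 (hne hv)
    push_cast
    constructor <;> linarith)
  push_cast at hs0
  -- the sum of the pairs
  have hsum : ∀ x, ∃ W E : ℝ, 0 ≤ W ∧ W ≤ 1 - L ∧ |E| ≤ ε - L * (ε / 2) ∧
      (∑ p, (ga p (a p x) + gc p (c p x)) = W * f x + E) ∧
      ∀ p : Fin m, (∃ z ∈ zset m K k, cu m (p + 1) K z x = 1) → 2 * L ≤ W := by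
    intro x
    have h1 := fun p : Fin m => pair_sum (cells m (p + 1) K hK0 (zset m K k)) f x
      (lam := 2 * L) (ε := ε / 2) (by positivity) (by positivity)
      (fun z _ hz => hnear _ z x hz)
    choose ω hω0 hω1 hωe hω using h1
    refine ⟨∑ p, 2 * L * ω p, ∑ p, (ga p (a p x) + gc p (c p x) - 2 * L * ω p * f x),
      Finset.sum_nonneg fun p _ => by have := hω0 p; positivity, ?_, ?_, ?_, ?_⟩
    · calc ∑ p, 2 * L * ω p ≤ ∑ p : Fin m, 2 * L := by
            apply Finset.sum_le_sum
            intro p _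
            have := hω1 p
            nlinarith
        _ = m * (2 * L) := by simp
        _ = 1 - L := hmL
    · calc _ ≤ ∑ p, |ga p (a p x) + gc p (c p x) - 2 * L * ω p * f x| :=
            Finset.abs_sum_le_sum_abs _ _
        _ ≤ ∑ p : Fin m, (2 * L * (ε / 2) + εk * (2 * L * M)) := by
            apply Finset.sum_le_sum
            intro p _
            have h1 := abs_le.1 (hω p)
            have h2 := abs_le.1 (hgab2 p x)
            rw [abs_le]; constructor <;> linarith
        _ = m * (2 * L) * (ε / 2 + εk * M) := by simp; ring
        _ ≤ ε - L * (ε / 2) := by rw [hmL]; nlinarith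
    · rw [Finset.sum_mul, ← Finset.sum_add_distrib]
      apply Finset.sum_congr rfl
      intro p _; ring
    · intro p hp
      have h2 : 2 * L * ω p ≤ ∑ p, 2 * L * ω p :=
        Finset.single_le_sum (f := fun p => 2 * L * ω p)
          (fun p _ => by have := hω0 p; positivity) (Finset.mem_univ p)
      rw [hωe p hp, mul_one] at h2
      exact h2
  have hsplit : ∀ x, ∑ i, famg g0 ga gc i (fam φ a c i x) =
      g0 (φ x) + ∑ p, (ga p (a p x) + gc p (c p x)) := by
    intro x
    rw [Fintype.sum_option, Fintype.sum_sum_type, Finset.sum_add_distrib]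
    rfl
  have hLM : L * M ≤ M := by nlinarith
  have hm1 : ∀ p : Fin m, 2 * L * M ≤ M := by
    intro p
    have : (1 : ℝ) ≤ m := by
      have := p.2
      exact_mod_cast (by omega : 1 ≤ m)
    have : 2 * L ≤ m * (2 * L) := by nlinarith
    nlinarith
  have hoff : ∀ x, 1 ≤ |‖x‖ - n| → g0 (φ x) = 0 := by
    intro x hx
    apply hs0
    rcases le_abs.1 hx with h | h
    · right
      have := (hW x ((n : ℤ) + 1)).2 (by push_cast; linarith)
      push_cast at this; exact this
    · left
      have := (hW x ((n : ℤ) - 1)).1 (by push_cast; linarith)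
      push_cast at this; exact this
  refine ⟨famg g0 ga gc, ?_, ?_, ?_, ?_, ?_⟩
  · exact fam_forall hg0c hgac hgcc
  · exact fam_forall (fun t => (hg0b t).trans hLM) (fun p t => (hgab p t).trans (hm1 p))
      (fun p t => (hgcb p t).trans (hm1 p))
  · have hpt : ∀ (p : Fin m) (t : ℝ), 3 ≤ |t - n| → ga p t = 0 ∧ gc p t = 0 := by
      intro p t ht
      apply hgs p t
      intro z hz hv
      have h1 := abs_lt.1 (hne hv)
      rcases le_abs.1 ht with h | h <;> rw [le_abs]
      · left; linarith
      · right; linarith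
    apply fam_forall
    · intro t ht
      apply hs0
      rcases le_abs.1 ht with h | h
      · right; linarith
      · left; linarith
    · exact fun p t ht => (hpt p t ht).1
    · exact fun p t ht => (hpt p t ht).2
  · intro x
    obtain ⟨W, E, hW0, hW1, hE, hWE, hgood⟩ := hsum x
    rw [hsplit, hWE]
    by_cases hx : 1 ≤ |‖x‖ - n|
    · rw [hoff x hx, hsupp x hx]
      simp only [mul_zero, zero_add, zero_sub, abs_neg]
      have : 0 ≤ (1 - L) * M := mul_nonneg (by linarith) hM
      have : 0 ≤ L * (ε / 2) := by positivity
      linarith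
    · refine final_est (lam := 2 * L) (E0 := L * (ε / 2)) hL.le rfl (hfM x) hW0 hW1 hE (hg0b _)
        (by positivity) ?_
      rw [not_le] at hx
      have hxk : ‖x‖ ≤ k := by
        have h1 := (abs_lt.1 hx).2
        have : ((n + 1 : ℕ) : ℝ) ≤ k := by exact_mod_cast hkn
        push_cast at this
        linarith
      obtain ⟨p, hp, z, hz⟩ := cover K x
      have hz0 : cu m p K z x ≠ 0 := by rw [hz]; exact one_ne_zero
      have hzm : z ∈ zset m K k := cu_mem hp hz0 hxk
      rcases Nat.eq_zero_or_pos p with rfl | hp0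
      · left
        rw [hg0v z hzm x hz, ← mul_sub, abs_mul, abs_of_pos hL]
        exact mul_le_mul_of_nonneg_left (hnear _ _ _ hz0) hL.le
      · right
        obtain ⟨q, rfl⟩ : ∃ q, p = q + 1 := ⟨p - 1, by omega⟩
        exact hgood ⟨q, by omega⟩ ⟨z, hzm, hz⟩
  · intro x hx
    obtain ⟨W, E, hW0, hW1, hE, hWE, hgood⟩ := hsum x
    rw [hsplit, hWE, hoff x hx, hsupp x hx]
    simp only [mul_zero, zero_add, zero_sub, abs_neg]
    have : 0 ≤ L * (ε / 2) := by positivity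
    linarith

end KST

namespace KST

open Set Filter Topology

lemma localIter {m : ℕ} {I : Type*} [Fintype I] {Φ : I → (Fin m → ℝ) → ℝ} {θ : ℝ}
    (hΦ : ∀ i, Continuous (Φ i)) (h : OneStep Φ θ) (hθ0 : 0 ≤ θ) {C : ℝ} (hC0 : 0 ≤ C)
    (hC : 1 + C * θ ≤ C) (n J : ℕ) :
    ∀ f : (Fin m → ℝ) → ℝ, Continuous f → (∀ x, 1 ≤ |‖x‖ - n| → f x = 0) →
    ∀ M, 0 ≤ M → (∀ x, |f x| ≤ M) → ∀ ε > 0, ∃ g : I → ℝ → ℝ, (∀ i, Continuous (g i)) ∧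
      (∀ i t, |g i t| ≤ C * M) ∧ (∀ i (t : ℝ), 3 ≤ |t - n| → g i t = 0) ∧
      (∀ x, |f x - ∑ i, g i (Φ i x)| ≤ θ ^ J * M + ε) := by
  induction J with
  | zero =>
    intro f hf hs M hM hfM ε hε
    refine ⟨fun _ _ => 0, fun _ => continuous_const, fun i t => by simp; positivity, by simp,
      fun x => ?_⟩
    have := hfM x
    simp only [Finset.sum_const_zero, sub_zero, pow_zero, one_mul]
    linarith
  | succ J ih =>
    intro f hf hs M hM hfM ε hε
    obtain ⟨g1, hg1c, hg1b, hg1s, hg1e, hg1o⟩ := h f hf n hs M hM hfM (ε / 2) (by positivity)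
    set r : (Fin m → ℝ) → ℝ := fun x => f x - ∑ i, g1 i (Φ i x) with hr
    have hrc : Continuous r := by
      rw [hr]
      fun_prop
    obtain ⟨g2, hg2c, hg2b, hg2s, hg2e⟩ := ih (fun x => r x - max (-(ε / 2)) (min (ε / 2) (r x)))
      (by fun_prop) (by
        intro x hx
        have h1 := abs_le.1 (hg1o x hx)
        beta_reduce
        rw [min_eq_right h1.2, max_eq_right h1.1, sub_self]) (θ * M) (by positivity) (by
        intro x
        have h1 := abs_le.1 (hg1e x)
        have h2 : 0 ≤ θ * M := by positivity
        change -(θ * M + ε / 2) ≤ r x ∧ r x ≤ θ * M + ε / 2 at h1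
        rcases le_total (ε / 2) (r x) with h3 | h3
        · rw [min_eq_left h3, max_eq_right (by linarith), abs_le]; constructor <;> linarith
        · rw [min_eq_right h3]
          rcases le_total (r x) (-(ε / 2)) with h4 | h4
          · rw [max_eq_left h4, abs_le]; constructor <;> linarith
          · rw [max_eq_right h4, sub_self, abs_zero]; exact h2) (ε / 2) (by positivity)
    refine ⟨fun i t => g1 i t + g2 i t, fun i => (hg1c i).add (hg2c i), fun i t => ?_, fun i t ht => ?_,
      fun x => ?_⟩
    · have h1 := hg1b i t
      have h2 := hg2b i t
      have h3 := abs_add_le (g1 i t) (g2 i t)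
      nlinarith
    · beta_reduce
      rw [hg1s i t ht, hg2s i t ht, add_zero]
    · have h1 := abs_le.1 (hg2e x)
      have h2 : |max (-(ε / 2)) (min (ε / 2) (r x))| ≤ ε / 2 := by
        rw [abs_le]
        exact ⟨le_max_left _ _, max_le (by linarith) (min_le_left _ _)⟩
      have h3 := abs_le.1 h2
      have e : f x - ∑ i, (g1 i (Φ i x) + g2 i (Φ i x)) = r x - ∑ i, g2 i (Φ i x) := by
        rw [Finset.sum_add_distrib, hr]; ring
      rw [e, pow_succ, abs_le]
      constructor <;> linarith

lemma localSol {m : ℕ} {I : Type*} [Fintype I] {Φ : I → (Fin m → ℝ) → ℝ} {θ : ℝ}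
    (hΦ : ∀ i, Continuous (Φ i)) (h : OneStep Φ θ) (hθ0 : 0 ≤ θ) (hθ1 : θ < 1) {C : ℝ} (hC0 : 0 ≤ C)
    (hC : 1 + C * θ ≤ C) (n : ℕ)
    (f : (Fin m → ℝ) → ℝ) (hf : Continuous f) (hs : ∀ x, 1 ≤ |‖x‖ - n| → f x = 0)
    (M : ℝ) (hM : 0 ≤ M) (hfM : ∀ x, |f x| ≤ M) (ε : ℝ) (hε : 0 < ε) :
    ∃ g : I → ℝ → ℝ, (∀ i, Continuous (g i)) ∧
      (∀ i t, |g i t| ≤ C * M) ∧ (∀ i (t : ℝ), 3 ≤ |t - n| → g i t = 0) ∧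
      (∀ x, |f x - ∑ i, g i (Φ i x)| ≤ ε) := by
  obtain ⟨J, hJ⟩ := exists_pow_lt_of_lt_one (show 0 < ε / (2 * (M + 1)) by positivity) hθ1
  obtain ⟨g, h1, h2, h3, h4⟩ := localIter hΦ h hθ0 hC0 hC n J f hf hs M hM hfM (ε / 2) (by positivity)
  refine ⟨g, h1, h2, h3, fun x => (h4 x).trans ?_⟩
  have : θ ^ J * M ≤ ε / (2 * (M + 1)) * (M + 1) :=
    mul_le_mul hJ.le (by linarith) hM (by positivity)
  have e : ε / (2 * (M + 1)) * (M + 1) = ε / 2 := by field_simp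
  linarith

lemma tent_sum {r : ℝ} (hr : 0 ≤ r) (N : ℕ) :
    ∑ n ∈ Finset.range N, tent 1 n r = max 0 (min 1 (N - r)) := by
  induction N with
  | zero => 
    simp only [Finset.range_zero, Finset.sum_empty, Nat.cast_zero, zero_sub]
    rw [max_eq_left ((min_le_right _ _).trans (by linarith))]
  | succ N ih =>
    rw [Finset.sum_range_succ, ih]
    unfold tent
    push_cast
    rw [div_one]
    rcases le_total r (N - 1) with h | h
    · rw [abs_of_nonpos (by linarith), min_eq_left (by linarith), min_eq_left (by linarith),
        max_eq_left (a := (0 : ℝ)) (b := 1 - -(r - N)) (by linarith)]; simp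
    · rcases le_total r N with h' | h'
      · rw [abs_of_nonpos (by linarith), min_eq_right (by linarith), min_eq_left (by linarith),
          max_eq_right (by linarith), max_eq_right (by linarith), max_eq_right (by linarith)]; ring
      · rw [abs_of_nonneg (by linarith), min_eq_right (by linarith), min_eq_right (by linarith),
          max_eq_left (by linarith)]
        ring_nf

lemma globalSol {m : ℕ} {I : Type*} [Fintype I] {Φ : I → (Fin m → ℝ) → ℝ} {θ : ℝ}
    (hΦ : ∀ i, Continuous (Φ i)) (h : OneStep Φ θ) (hθ0 : 0 ≤ θ) (hθ1 : θ < 1) {C : ℝ} (hC0 : 0 ≤ C)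
    (hC : 1 + C * θ ≤ C)
    (f : (Fin m → ℝ) → ℝ) (hf : Continuous f) (M : ℕ → ℝ) (hM : ∀ n, 0 ≤ M n)
    (hfM : ∀ (n : ℕ) x, ‖x‖ ≤ (n : ℝ) + 1 → |f x| ≤ M n) (ε : ℝ) (hε : 0 < ε) :
    ∃ g : I → ℝ → ℝ, (∀ i, Continuous (g i)) ∧
      (∀ B, (∀ n, M n ≤ B) → ∀ i t, |g i t| ≤ 6 * (C * B)) ∧
      (∀ x, |f x - ∑ i, g i (Φ i x)| ≤ ε) := by
  have hloc := fun n : ℕ => localSol hΦ h hθ0 hθ1 hC0 hC n (fun x => tent 1 n ‖x‖ * f x)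
    (by have := tent_cont 1 n; fun_prop)
    (fun x hx => by rw [tent_zero one_pos hx, zero_mul]) (M n) (hM n) (fun x => by
      by_cases hx : 1 ≤ |‖x‖ - n|
      · rw [tent_zero one_pos hx, zero_mul, abs_zero]; exact hM n
      · rw [not_le] at hx
        have h1 := hfM n x (by have := (abs_lt.1 hx).2; linarith)
        obtain ⟨h2, h3⟩ := tent_mem (σ := 1) (τ := n) (κ := ‖x‖) one_pos
        rw [abs_mul, abs_of_nonneg h2]
        nlinarith [abs_nonneg (f x)]) (ε / 2 / 2 ^ n) (by positivity)
  choose G hGc hGb hGs hGe using hloc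
  have heval : ∀ i (t : ℝ) (N : ℕ), t + 3 ≤ N → ∑ᶠ n, G n i t = ∑ n ∈ Finset.range N, G n i t := by
    intro i t N hN
    apply finsum_eq_sum_of_support_subset
    intro n hn
    rw [Function.mem_support] at hn
    simp only [Finset.coe_range, mem_Iio]
    by_contra hc
    apply hn
    apply hGs
    have : (N : ℝ) ≤ n := by exact_mod_cast not_lt.1 hc
    rw [le_abs]; right; linarith
  refine ⟨fun i t => ∑ᶠ n, G n i t, fun i => ?_, fun B hB i t => ?_, fun x => ?_⟩
  · apply continuous_finsum (fun n => hGc n i)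
    intro t
    refine ⟨Metric.ball t 1, Metric.ball_mem_nhds t one_pos, ?_⟩
    apply (Finset.finite_toSet (Finset.range (⌈t + 4⌉₊))).subset
    rintro n ⟨y, hy, hyt⟩
    rw [Function.mem_support] at hy
    rw [Metric.mem_ball, Real.dist_eq] at hyt
    simp only [Finset.coe_range, mem_Iio]
    rw [Nat.lt_ceil]
    by_contra hc
    apply hy
    apply hGs
    have := (abs_lt.1 hyt).2
    rw [le_abs]; right; linarith
  · beta_reduce
    have hB0 : 0 ≤ B := (hM 0).trans (hB 0)
    set j := ⌈t - 3⌉₊ with hj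
    have hj1 : t - 3 ≤ j := Nat.le_ceil _
    have e : ∑ᶠ n, G n i t = ∑ n ∈ Finset.Ico j (j + 6), G n i t := by
      apply finsum_eq_sum_of_support_subset
      intro n hn
      rw [Function.mem_support] at hn
      simp only [Finset.coe_Ico, mem_Ico]
      have h1 : |t - n| < 3 := by
        by_contra hc
        exact hn (hGs n i t (not_lt.1 hc))
      obtain ⟨h2, h3⟩ := abs_lt.1 h1
      constructor
      · rw [hj, Nat.ceil_le]; linarith
      · have : (n : ℝ) < ((j + 6 : ℕ) : ℝ) := by push_cast; linarith
        exact_mod_cast this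
    rw [e]
    calc _ ≤ ∑ n ∈ Finset.Ico j (j + 6), |G n i t| := Finset.abs_sum_le_sum_abs _ _
      _ ≤ ∑ n ∈ Finset.Ico j (j + 6), C * B := Finset.sum_le_sum fun n _ =>
          (hGb n i t).trans (mul_le_mul_of_nonneg_left (hB n) hC0)
      _ = 6 * (C * B) := by simp
  · beta_reduce
    obtain ⟨N, hN⟩ := exists_nat_ge (∑ i, |Φ i x| + 3 + ‖x‖)
    have hNi : ∀ i, Φ i x + 3 ≤ N := by
      intro i
      have h1 : |Φ i x| ≤ ∑ i, |Φ i x| :=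
        Finset.single_le_sum (f := fun i => |Φ i x|) (fun i _ => abs_nonneg _) (Finset.mem_univ i)
      have h2 := le_abs_self (Φ i x)
      have h3 := norm_nonneg x
      linarith
    have hNx : 1 ≤ N - ‖x‖ := by
      have h1 : 0 ≤ ∑ i, |Φ i x| := Finset.sum_nonneg fun i _ => abs_nonneg _
      linarith
    have e1 : f x = ∑ n ∈ Finset.range N, tent 1 n ‖x‖ * f x := by
      rw [← Finset.sum_mul, tent_sum (norm_nonneg x), min_eq_left hNx, max_eq_right zero_le_one,
        one_mul]
    have e2 : ∑ i, ∑ᶠ n, G n i (Φ i x) = ∑ n ∈ Finset.range N, ∑ i, G n i (Φ i x) := by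
      rw [Finset.sum_comm]
      exact Finset.sum_congr rfl fun i _ => heval i _ N (hNi i)
    rw [e2]
    nth_rewrite 1 [e1]
    rw [← Finset.sum_sub_distrib]
    calc _ ≤ ∑ n ∈ Finset.range N, |tent 1 n ‖x‖ * f x - ∑ i, G n i (Φ i x)| :=
          Finset.abs_sum_le_sum_abs _ _
      _ ≤ ∑ n ∈ Finset.range N, ε / 2 / 2 ^ n := Finset.sum_le_sum fun n _ => hGe n x
      _ ≤ ∑' n : ℕ, ε / 2 / 2 ^ n := 
          Summable.sum_le_tsum _ (fun n _ => by positivity) (summable_geometric_two' ε)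
      _ = ε := tsum_geometric_two' ε

lemma finalSol {m : ℕ} {I : Type*} [Fintype I] {Φ : I → (Fin m → ℝ) → ℝ} {θ : ℝ}
    (hΦ : ∀ i, Continuous (Φ i)) (h : OneStep Φ θ) (hθ0 : 0 ≤ θ) (hθ1 : θ < 1)
    (f : (Fin m → ℝ) → ℝ) (hf : Continuous f) :
    ∃ g : I → ℝ → ℝ, (∀ i, Continuous (g i)) ∧ ∀ x, f x = ∑ i, g i (Φ i x) := by
  set C := 1 / (1 - θ) with hCdef
  have h1θ : 0 < 1 - θ := by linarith
  have hC0 : 0 ≤ C := by positivity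
  have hC : 1 + C * θ ≤ C := by
    have : C * (1 - θ) = 1 := by rw [hCdef]; field_simp
    linarith
  -- first approximation
  have hbd : ∀ n : ℕ, ∃ M : ℝ, 0 ≤ M ∧ ∀ x, ‖x‖ ≤ (n : ℝ) + 1 → |f x| ≤ M := by
    intro n
    obtain ⟨M, hM⟩ := (isCompact_closedBall (0 : Fin m → ℝ) (n + 1)).exists_bound_of_continuousOn
      hf.continuousOn
    refine ⟨|M|, abs_nonneg _, fun x hx => (hM x (by simpa using hx)).trans (le_abs_self _)⟩
  choose M hM0 hM using hbd
  obtain ⟨g0, hg0c, -, hg0e⟩ := globalSol hΦ h hθ0 hθ1 hC0 hC f hf M hM0 hM 1 one_pos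
  -- iteration
  let P : ℕ → ((Fin m → ℝ) → ℝ) → Prop := fun j k => Continuous k ∧ ∀ x, |k x| ≤ (1 / 2) ^ j
  have hstep : ∀ j (k : {k // P j k}), ∃ g : I → ℝ → ℝ, (∀ i, Continuous (g i)) ∧
      (∀ i t, |g i t| ≤ 6 * (C * (1 / 2) ^ j)) ∧ P (j + 1) (fun x => k.1 x - ∑ i, g i (Φ i x)) := by
    rintro j ⟨k, hkc, hkb⟩
    obtain ⟨g, hgc, hgb, hge⟩ := globalSol hΦ h hθ0 hθ1 hC0 hC k hkc (fun _ => (1 / 2) ^ j)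
      (fun _ => by positivity) (fun _ x _ => hkb x) ((1 / 2) ^ (j + 1)) (by positivity)
    exact ⟨g, hgc, hgb _ (fun _ => le_rfl),
      (by show Continuous (fun x => k x - ∑ i, g i (Φ i x)); fun_prop), hge⟩
  choose G hGc hGb hGP using hstep
  let H : ∀ j, {k // P j k} := fun j => Nat.rec
    ⟨fun x => f x - ∑ i, g0 i (Φ i x), by fun_prop, fun x => by simpa using hg0e x⟩
    (fun j k => ⟨fun x => k.1 x - ∑ i, G j k i (Φ i x), hGP j k⟩) j
  have hH0 : ∀ x, (H 0).1 x = f x - ∑ i, g0 i (Φ i x) := fun x => rfl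
  have hHs : ∀ j x, (H (j + 1)).1 x = (H j).1 x - ∑ i, G j (H j) i (Φ i x) := fun j x => rfl
  have hsumm : Summable (fun j : ℕ => 6 * (C * (1 / 2 : ℝ) ^ j)) :=
    (summable_geometric_two.mul_left C).mul_left 6
  refine ⟨fun i t => g0 i t + ∑' j, G j (H j) i t, fun i => ?_, fun x => ?_⟩
  · exact (hg0c i).add (continuous_tsum (fun j => hGc j (H j) i) hsumm
      (fun j t => hGb j (H j) i t))
  · have hs : ∀ i, HasSum (fun j => G j (H j) i (Φ i x)) (∑' j, G j (H j) i (Φ i x)) := fun i =>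
      (Summable.of_norm_bounded hsumm (fun j => hGb j (H j) i _)).hasSum
    have hs2 := (hasSum_sum (s := Finset.univ) fun i _ => hs i).tendsto_sum_nat
    have hpart : ∀ N, ∑ j ∈ Finset.range N, ∑ i, G j (H j) i (Φ i x) = (H 0).1 x - (H N).1 x := by
      intro N
      induction N with
      | zero => simp
      | succ N ih => rw [Finset.sum_range_succ, ih, hHs]; ring
    have hlim : Tendsto (fun N => (H N).1 x) atTop (𝓝 0) := by
      apply squeeze_zero_norm (fun N => (H N).2.2 x)
      exact tendsto_pow_atTop_nhds_zero_of_lt_one (by norm_num) (by norm_num)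
    have hlim2 : Tendsto (fun N => ∑ j ∈ Finset.range N, ∑ i, G j (H j) i (Φ i x)) atTop
        (𝓝 ((H 0).1 x)) := by
      simp only [hpart]
      simpa using tendsto_const_nhds.sub hlim
    have := tendsto_nhds_unique hs2 hlim2
    rw [hH0] at this
    rw [Finset.sum_add_distrib, this]; ring

end KST

/-- `ℝ^m` has a finite basic family of `2m+1` continuous functions:
there are continuous `φ q : ℝ^m → ℝ` such that every continuous
`f : ℝ^m → ℝ` can be written `f = ∑ q, g q ∘ φ q` with continuous `g q`. -/
theorem Rm_has_finite_basic_family (m : ℕ) (hm : 1 ≤ m) :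
    ∃ φ : Fin (2 * m + 1) → (Fin m → ℝ) → ℝ,
      (∀ q, Continuous (φ q)) ∧
      ∀ f : (Fin m → ℝ) → ℝ, Continuous f →
        ∃ g : Fin (2 * m + 1) → ℝ → ℝ,
          (∀ q, Continuous (g q)) ∧
          ∀ x : Fin m → ℝ, f x = ∑ q : Fin (2 * m + 1), g q (φ q x) := by
  obtain ⟨φ, a, c, hφ, ha, hc, hW, hk⟩ := KST.exists_family m hm
  have hcont : ∀ i, Continuous (KST.fam φ a c i) := KST.fam_forall hφ ha hc
  have hstep := KST.oneStep hW hk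
  have hL : (0 : ℝ) < 1 / (2 * m + 1) := by positivity
  have hL1 : (1 : ℝ) / (2 * m + 1) ≤ 1 := by
    rw [div_le_one (by positivity)]
    have : (0 : ℝ) ≤ m := by positivity
    linarith
  have e : Option (Fin m ⊕ Fin m) ≃ Fin (2 * m + 1) := Fintype.equivFinOfCardEq (by simp; ring)
  refine ⟨fun q => KST.fam φ a c (e.symm q), fun q => hcont _, fun f hf => ?_⟩
  obtain ⟨g, hg, hgf⟩ := KST.finalSol hcont hstep (by linarith) (by linarith) f hf
  refine ⟨fun q => g (e.symm q), fun q => hg _, fun x => ?_⟩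
  rw [hgf x]
  exact (Equiv.sum_comp e.symm (fun i => g i (KST.fam φ a c i x))).symm
end

section
/- Fix m ∈ ℕ, m ≥ 1. There exist continuous functions ψ^{pq} : ℝ → ℝ (q = 1,…,2m+1, p = 1,…,m) such that, setting φ^q(x_1,…,x_m) = Σ_{p=1}^{m} ψ^{pq}(x_p), every compactly supported continuous function h : ℝ^m → ℝ can be written h = Σ_{q=1}^{2m+1} g_q ∘ φ^q where each g_q : ℝ → ℝ is continuous and compactly supported. -/
/-- continuous staircase -/
noncomputable def stair (n : ℝ) (y : ℝ) : ℝ := y + (max 0 (n * Int.fract y - (n-1)) - Int.fract y)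

lemma stair_cont (n : ℝ) (hn : 1 ≤ n) : Continuous (stair n) := by
  unfold stair
  refine continuous_id.add ?_
  have := ContinuousOn.comp_fract'' (f := fun y : ℝ => max 0 (n * y - (n-1)) - y)
    (by fun_prop) (by simp; linarith)
  exact this

lemma stair_good (n y : ℝ) (h : n * Int.fract y ≤ n - 1) : stair n y = (⌊y⌋ : ℝ) := by
  unfold stair
  rw [max_eq_left (by linarith)]
  have := Int.floor_add_fract y
  linarith

lemma stair_near (n y : ℝ) (hn : 1 ≤ n) : |stair n y - y| ≤ 1 := by
  unfold stair
  have h0 := Int.fract_nonneg y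
  have h1 := (Int.fract_lt_one y).le
  have h2 : max 0 (n * Int.fract y - (n-1)) ≤ 1 := max_le (by norm_num) (by nlinarith)
  have h3 : 0 ≤ max 0 (n * Int.fract y - (n-1)) := le_max_left _ _
  rw [abs_le]; constructor <;> linarith

lemma bad_unique (n : ℕ) (y : ℝ) (q q' : Fin n)
    (h : ¬ (n : ℝ) * Int.fract (y + q / n) ≤ n - 1) (h' : ¬ (n : ℝ) * Int.fract (y + q' / n) ≤ n - 1) :
    q = q' := by
  have hn : (0 : ℝ) < n := by exact_mod_cast q.pos
  have e1 := Int.floor_add_fract (y + (q:ℝ) / n)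
  have e2 := Int.floor_add_fract (y + (q':ℝ) / n)
  have l1 := Int.fract_lt_one (y + (q:ℝ) / n)
  have l2 := Int.fract_lt_one (y + (q':ℝ) / n)
  set k := ⌊y + (q:ℝ) / n⌋
  set k' := ⌊y + (q':ℝ) / n⌋
  set f := Int.fract (y + (q:ℝ) / n)
  set f' := Int.fract (y + (q':ℝ) / n)
  push Not at h h'
  have e3 : (n:ℝ) * k + n * f = n * y + q := by
    have := congrArg (fun z => (n:ℝ) * z) e1
    simp only [mul_add] at this
    rw [this]; field_simp
  have e4 : (n:ℝ) * k' + n * f' = n * y + q' := by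
    have := congrArg (fun z => (n:ℝ) * z) e2
    simp only [mul_add] at this
    rw [this]; field_simp
  have l3 : (n:ℝ) * f < n := by nlinarith
  have l4 : (n:ℝ) * f' < n := by nlinarith
  have a1 : ((q:ℤ) - q' - n * (k - k') : ℝ) < 1 := by push_cast; linarith
  have a2 : (-1:ℝ) < ((q:ℤ) - q' - n * (k - k') : ℝ) := by push_cast; linarith
  have b1 : ((q:ℤ) - q' - n * (k - k') : ℤ) < 1 := by exact_mod_cast a1
  have b2 : (-1:ℤ) < ((q:ℤ) - q' - n * (k - k') : ℤ) := by exact_mod_cast a2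
  have b3 : (q:ℤ) - q' = n * (k - k') := by omega
  have hq := q.isLt
  have hq' := q'.isLt
  have : k - k' = 0 := by
    by_contra hne
    rcases lt_or_gt_of_ne hne with h | h
    · have : (n:ℤ) * (k - k') ≤ n * (-1) := by
        apply mul_le_mul_of_nonneg_left <;> omega
      omega
    · have : (n:ℤ) * 1 ≤ n * (k - k') := by
        apply mul_le_mul_of_nonneg_left <;> omega
      omega
  rw [this] at b3
  ext; omega

lemma perturb (m N : ℕ) (c : (Fin m → Fin (N+1)) → ℝ) (τ : ℝ) (hτ : 0 < τ) :
    ∃ t : ℝ, 0 < t ∧ t < τ ∧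
      Function.Injective (fun J : Fin m → Fin (N+1) =>
        c J + t * ∑ p, ((J p : ℕ) : ℝ) * ((N:ℝ)+1)^(p:ℕ)) := by
  classical
  set A : (Fin m → Fin (N+1)) → ℝ := fun J => ∑ p, ((J p : ℕ) : ℝ) * ((N:ℝ)+1)^(p:ℕ) with hA
  have hAi : Function.Injective A := by
    intro J J' h
    apply finFunctionFinEquiv.injective
    apply Fin.ext
    rw [finFunctionFinEquiv_apply, finFunctionFinEquiv_apply]
    simp only [hA] at h
    exact_mod_cast h
  obtain ⟨t, ht, htn⟩ := (Set.Ioo_infinite hτ).exists_notMem_finset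
    ((Finset.univ : Finset ((Fin m → Fin (N+1)) × (Fin m → Fin (N+1)))).image
      (fun P => -(c P.1 - c P.2) / (A P.1 - A P.2)))
  refine ⟨t, ht.1, ht.2, ?_⟩
  intro J J' h
  by_contra hne
  apply htn
  rw [Finset.mem_image]
  refine ⟨(J, J'), Finset.mem_univ _, ?_⟩
  have h1 : A J - A J' ≠ 0 := sub_ne_zero.2 (fun e => hne (hAi e))
  simp only at h ⊢
  rw [div_eq_iff h1]
  linarith

open unitInterval in
lemma perq (m n N : ℕ) (hN : 1 ≤ N) (hn : 1 ≤ n) (q : Fin n) (ψ₀ : Fin m → C(I, ℝ)) (h : C(Fin m → I, ℝ))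
    (ε η : ℝ) (hε : 0 < ε)
    (hψ : ∀ p, ∀ x y : I, |(x:ℝ) - y| ≤ 1 / N → |ψ₀ p x - ψ₀ p y| < ε / 2)
    (hh : ∀ x y : Fin m → I, (∀ p, |(x p:ℝ) - y p| ≤ 1 / N) → |h x - h y| ≤ η) :
    ∃ ψ : Fin m → C(I, ℝ), (∀ p, ‖ψ p - ψ₀ p‖ < ε) ∧
      ∃ g : BoundedContinuousFunction ℝ ℝ, ‖g‖ ≤ ‖h‖ / n ∧
        ∀ x : Fin m → I, (∀ p, (n:ℝ) * Int.fract ((N:ℝ) * x p + q / n) ≤ n - 1) →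
          |h x / n - g (∑ p, ψ p (x p))| ≤ η / n := by
  have hn0 : (0:ℝ) < n := by exact_mod_cast hn
  have hn1 : (1:ℝ) ≤ n := by exact_mod_cast hn
  have hN0 : (0:ℝ) < N := by exact_mod_cast hN
  set a : ℝ := (q:ℝ) / n with ha
  have ha0 : 0 ≤ a := by positivity
  have ha1 : a < 1 := by
    rw [ha, div_lt_one hn0]; exact_mod_cast q.isLt
  have z01 : (0:ℝ) ≤ 1 := zero_le_one
  let F : Fin m → ℝ → ℝ := fun p y => ψ₀ p (Set.projIcc 0 1 z01 ((y - a) / N))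
  have hτ : 0 < ε / 2 / ((N + 2) * ((N:ℝ)+1)^m) := by positivity
  obtain ⟨t, ht0, htτ, hinj⟩ := perturb m N (fun J => ∑ p, F p ((J p : ℕ) : ℝ)) _ hτ
  let S : I → ℝ := fun x => stair n (N * x + a)
  have hS : Continuous S := (stair_cont n hn1).comp (by fun_prop)
  let ψ : Fin m → C(I, ℝ) := fun p =>
    ⟨fun x => F p (S x) + t * (S x * ((N:ℝ)+1)^(p:ℕ)), by
      refine Continuous.add ?_ (by fun_prop)
      exact (ψ₀ p).continuous.comp (continuous_projIcc.comp (by fun_prop))⟩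
  have hSn : ∀ x : I, |S x - (N * x + a)| ≤ 1 := fun x => stair_near n _ hn1
  refine ⟨ψ, ?_, ?_⟩
  · intro p
    rw [ContinuousMap.norm_lt_iff _ hε]
    intro x
    have h1 : |F p (S x) - ψ₀ p x| < ε / 2 := by
      apply hψ
      have := Set.abs_projIcc_sub_projIcc (c := (S x - a) / N) (d := (x:ℝ)) z01
      rw [Set.projIcc_val] at this
      refine this.trans ?_
      have e : (S x - a) / N - x = (S x - (N * x + a)) / N := by field_simp; ring
      rw [e, abs_div, abs_of_pos hN0]
      gcongr
      exact hSn x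
    have h2 : |t * (S x * ((N:ℝ)+1)^(p:ℕ))| ≤ ε / 2 := by
      have hs : |S x| ≤ N + 2 := by
        have := abs_le.1 (hSn x)
        have hx0 := x.2.1
        have hx1 := x.2.2
        have : (N:ℝ) * x ≤ N := by nlinarith
        have : 0 ≤ (N:ℝ) * x := by positivity
        rw [abs_le]; constructor <;> linarith
      have hp : ((N:ℝ)+1)^(p:ℕ) ≤ ((N:ℝ)+1)^m :=
        pow_le_pow_right₀ (by linarith) p.isLt.le
      rw [abs_mul, abs_mul, abs_of_pos ht0, abs_of_pos (a := ((N:ℝ)+1)^(p:ℕ)) (by positivity)]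
      calc t * (|S x| * ((N:ℝ)+1)^(p:ℕ)) ≤ t * ((N+2) * ((N:ℝ)+1)^m) := by gcongr
        _ ≤ ε / 2 := by
          rw [lt_div_iff₀ (by positivity)] at htτ
          exact htτ.le
    change |F p (S x) + t * (S x * ((N:ℝ)+1)^(p:ℕ)) - ψ₀ p x| < ε
    have := abs_add_le (F p (S x) - ψ₀ p x) (t * (S x * ((N:ℝ)+1)^(p:ℕ)))
    rw [show F p (S x) + t * (S x * ((N:ℝ)+1)^(p:ℕ)) - ψ₀ p x
      = (F p (S x) - ψ₀ p x) + t * (S x * ((N:ℝ)+1)^(p:ℕ)) by ring]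
    linarith
  · have hfl : ∀ x : I, 0 ≤ ⌊(N:ℝ) * x + a⌋ ∧ ⌊(N:ℝ) * x + a⌋ < N + 1 := by
      intro x
      have hx0 := x.2.1
      have hx1 := x.2.2
      have : (N:ℝ) * x ≤ N := by nlinarith
      have : 0 ≤ (N:ℝ) * x := by positivity
      constructor
      · apply Int.floor_nonneg.2; linarith
      · rw [Int.floor_lt]; push_cast; linarith
    let fl : (Fin m → I) → (Fin m → Fin (N+1)) := fun x p =>
      ⟨⌊(N:ℝ) * x p + a⌋.toNat, by have := hfl (x p); omega⟩
    have hflv : ∀ x p, (((fl x p : ℕ) : ℤ)) = ⌊(N:ℝ) * x p + a⌋ := by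
      intro x p
      exact Int.toNat_of_nonneg (hfl (x p)).1
    let w : (Fin m → Fin (N+1)) → ℝ := fun J => h (Function.invFun fl J) / n
    have hwb : ∀ J, ‖w J‖ ≤ ‖h‖ / n := by
      intro J
      simp only [w]
      rw [norm_div, Real.norm_of_nonneg hn0.le]
      gcongr
      exact h.norm_coe_le_norm _
    have hcl := Continuous.isClosedEmbedding (continuous_of_discreteTopology) hinj
    let wb : BoundedContinuousFunction (Fin m → Fin (N+1)) ℝ :=
      BoundedContinuousFunction.ofNormedAddCommGroup w continuous_of_discreteTopology _ hwb
    obtain ⟨g, hg, hge⟩ :=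
      BoundedContinuousFunction.exists_extension_norm_eq_of_isClosedEmbedding wb hcl
    refine ⟨g, ?_, ?_⟩
    · rw [hg]
      exact BoundedContinuousFunction.norm_ofNormedAddCommGroup_le _ (by positivity) _
    · intro x hx
      have e1 : ∑ p, ψ p (x p) = ∑ p, F p ((fl x p : ℕ) : ℝ)
          + t * ∑ p, ((fl x p : ℕ) : ℝ) * ((N:ℝ)+1)^(p:ℕ) := by
        rw [Finset.mul_sum, ← Finset.sum_add_distrib]
        refine Finset.sum_congr rfl fun p _ => ?_
        have e2 : S (x p) = ((fl x p : ℕ) : ℝ) := by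
          have := stair_good n (N * x p + a) (hx p)
          rw [← hflv] at this
          exact_mod_cast this
        change F p (S (x p)) + t * (S (x p) * ((N:ℝ)+1)^(p:ℕ)) = _
        rw [e2]
      have e3 := congrFun hge (fl x)
      simp only [Function.comp] at e3
      rw [e1, e3]
      change |h x / n - h (Function.invFun fl (fl x)) / n| ≤ η / n
      rw [← sub_div, abs_div, abs_of_pos hn0]
      gcongr
      apply hh
      intro p
      have e4 : fl (Function.invFun fl (fl x)) = fl x := Function.invFun_eq ⟨x, rfl⟩
      set x' := Function.invFun fl (fl x)
      have e5 : ⌊(N:ℝ) * x p + a⌋ = ⌊(N:ℝ) * x' p + a⌋ := by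
        rw [← hflv, ← hflv, e4]
      have e6 := Int.abs_sub_lt_one_of_floor_eq_floor e5
      rw [le_div_iff₀ hN0, ← abs_of_pos hN0, ← abs_mul]
      refine le_trans (le_of_eq ?_) e6.le
      congr 1; ring

open unitInterval in
/-- The inner functions. -/
noncomputable def innerPhi {m n : ℕ} (ψ : Fin m → Fin n → C(I, ℝ)) (q : Fin n) : C(Fin m → I, ℝ) :=
  ∑ p, (ψ p q).comp ⟨fun x => x p, continuous_apply p⟩

open unitInterval in
lemma innerPhi_apply {m n : ℕ} (ψ : Fin m → Fin n → C(I, ℝ)) (q : Fin n) (x : Fin m → I) :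
    innerPhi ψ q x = ∑ p, ψ p q (x p) := by
  simp [innerPhi]

open unitInterval in
/-- The superposition operator. -/
noncomputable def superT {m n : ℕ} (ψ : Fin m → Fin n → C(I, ℝ))
    (g : Fin n → BoundedContinuousFunction ℝ ℝ) : C(Fin m → I, ℝ) :=
  ∑ q, (g q).toContinuousMap.comp (innerPhi ψ q)

open unitInterval in
lemma superT_apply {m n : ℕ} (ψ : Fin m → Fin n → C(I, ℝ))
    (g : Fin n → BoundedContinuousFunction ℝ ℝ) (x : Fin m → I) :
    superT ψ g x = ∑ q, g q (∑ p, ψ p q (x p)) := by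
  simp [superT, innerPhi_apply]

open unitInterval in
lemma superT_cont {m n : ℕ} (g : Fin n → BoundedContinuousFunction ℝ ℝ) :
    Continuous (fun ψ : Fin m → Fin n → C(I, ℝ) => superT ψ g) := by
  unfold superT
  refine continuous_finsetSum _ fun q _ => ?_
  refine (ContinuousMap.continuous_postcomp _).comp ?_
  unfold innerPhi
  refine continuous_finsetSum _ fun p _ => ?_
  refine (ContinuousMap.continuous_precomp _).comp ?_
  fun_prop

open unitInterval in
/-- The approximation sets for the category argument. -/
def goodSet (m n : ℕ) (θ : ℝ) (h : C(Fin m → I, ℝ)) : Set (Fin m → Fin n → C(I, ℝ)) :=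
  {ψ | ∃ g : Fin n → BoundedContinuousFunction ℝ ℝ, (∀ q, ‖g q‖ ≤ ‖h‖) ∧
    ‖h - superT ψ g‖ < θ * ‖h‖}

open unitInterval in
lemma goodSet_open (m n : ℕ) (θ : ℝ) (h : C(Fin m → I, ℝ)) : IsOpen (goodSet m n θ h) := by
  have : goodSet m n θ h = ⋃ g : {g : Fin n → BoundedContinuousFunction ℝ ℝ // ∀ q, ‖g q‖ ≤ ‖h‖},
      {ψ | ‖h - superT ψ g.1‖ < θ * ‖h‖} := by
    ext ψ
    simp [goodSet]
  rw [this]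
  refine isOpen_iUnion fun g => ?_
  exact isOpen_lt (continuous_const.sub (superT_cont g.1)).norm continuous_const

open unitInterval in
lemma goodSet_dense (m : ℕ) (h : C(Fin m → I, ℝ)) (hh : h ≠ 0) :
    Dense (goodSet m (2*m+1) ((2*m+1/2)/(2*m+1)) h) := by
  have hnorm : 0 < ‖h‖ := norm_pos_iff.2 hh
  obtain ⟨n, hn⟩ : ∃ n : ℕ, n = 2 * m + 1 := ⟨_, rfl⟩
  rw [← hn, Metric.dense_iff]
  intro ψ₀ ε hε
  have hnR : (n : ℝ) = 2 * m + 1 := by rw [hn]; push_cast; ring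
  have hn0 : (0:ℝ) < n := by rw [hnR]; positivity
  set η : ℝ := ‖h‖ / (4 * n) with hη
  have hη0 : 0 < η := by positivity
  have u1 : UniformContinuous (fun x : I => fun p q => ψ₀ p q x) :=
    CompactSpace.uniformContinuous_of_continuous (by fun_prop)
  have u2 : UniformContinuous h := CompactSpace.uniformContinuous_of_continuous h.continuous
  obtain ⟨δ₁, hδ₁, u1⟩ := Metric.uniformContinuous_iff.1 u1 (ε/2) (by positivity)
  obtain ⟨δ₂, hδ₂, u2⟩ := Metric.uniformContinuous_iff.1 u2 η hη0
  obtain ⟨N', hN'⟩ := exists_nat_one_div_lt (lt_min hδ₁ hδ₂)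
  set N := N' + 1 with hN
  have hN1 : (1:ℝ) / N < min δ₁ δ₂ := by rw [hN]; push_cast; exact hN'
  have key := fun q : Fin n => perq m n N (by omega) (by omega) q (fun p => ψ₀ p q) h ε η hε
    (by
      intro p x y hxy
      have := u1 (a := x) (b := y) (lt_of_le_of_lt (by simpa [Subtype.dist_eq, Real.dist_eq] using hxy)
        (hN1.trans_le (min_le_left _ _)))
      have := (dist_pi_lt_iff (by positivity)).1 this p
      have := (dist_pi_lt_iff (by positivity)).1 this q
      rwa [Real.dist_eq] at this)
    (by
      intro x y hxy
      have := u2 (a := x) (b := y) ((dist_pi_lt_iff hδ₂).2 fun p =>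
        lt_of_le_of_lt (by simpa [Subtype.dist_eq, Real.dist_eq] using hxy p)
        (hN1.trans_le (min_le_right _ _)))
      rw [Real.dist_eq] at this
      exact this.le)
  choose ψ hψ g hg hgx using key
  refine ⟨fun p q => ψ q p, ?_, g, ?_, ?_⟩
  · rw [Metric.mem_ball, dist_pi_lt_iff hε]
    intro p
    rw [dist_pi_lt_iff hε]
    intro q
    rw [dist_eq_norm]
    exact hψ q p
  · intro q
    refine (hg q).trans (div_le_self hnorm.le ?_)
    rw [hnR]; have : (0:ℝ) ≤ m := by positivity
    linarith
  · rw [ContinuousMap.norm_lt_iff _ (by positivity)]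
    intro x
    rw [ContinuousMap.sub_apply, superT_apply]
    classical
    let bad : Finset (Fin n) :=
      Finset.univ.filter fun q => ¬ ∀ p, (n:ℝ) * Int.fract ((N:ℝ) * x p + q / n) ≤ n - 1
    have hbad : bad.card ≤ m := by
      have hex : ∀ q ∈ bad, ∃ p, ¬ (n:ℝ) * Int.fract ((N:ℝ) * x p + q / n) ≤ n - 1 := by
        intro q hq
        simpa only [not_forall] using (Finset.mem_filter.1 hq).2
      rcases bad.eq_empty_or_nonempty with hemp | ⟨q₀, hq₀⟩
      · simp [hemp]
      have : Nonempty (Fin m) := ⟨(hex q₀ hq₀).choose⟩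
      choose! f hf using hex
      have := Finset.card_le_card_of_injOn (s := bad) (t := (Finset.univ : Finset (Fin m))) f
        (fun _ _ => Finset.mem_coe.2 (Finset.mem_univ _)) (by
          intro q hq q' hq' e
          have h1 := hf q hq
          have h2 := hf q' hq'
          rw [← e] at h2
          exact bad_unique n _ q q' h1 h2)
      simpa using this
    have e1 : h x - ∑ q, g q (∑ p, ψ q p (x p)) = ∑ q, (h x / n - g q (∑ p, ψ q p (x p))) := by
      rw [Finset.sum_sub_distrib]
      simp
      field_simp
    have hx : |h x| ≤ ‖h‖ := h.norm_coe_le_norm x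
    have e2 : ∀ q, |h x / n - g q (∑ p, ψ q p (x p))| ≤ η / n + if q ∈ bad then 2 * ‖h‖ / n else 0 := by
      intro q
      split_ifs with hq
      · have h1 : |g q (∑ p, ψ q p (x p))| ≤ ‖h‖ / n := ((g q).norm_coe_le_norm _).trans (hg q)
        have h2 : |h x / n| ≤ ‖h‖ / n := by rw [abs_div, abs_of_pos hn0]; gcongr
        have h3 := abs_sub (h x / n) (g q (∑ p, ψ q p (x p)))
        have : 2 * ‖h‖ / n = ‖h‖ / n + ‖h‖ / n := by ring
        have : 0 ≤ η / n := by positivity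
        linarith
      · rw [add_zero]
        apply hgx q x
        by_contra hc
        exact hq (Finset.mem_filter.2 ⟨Finset.mem_univ _, hc⟩)
    rw [e1]
    calc ‖∑ q, (h x / n - g q (∑ p, ψ q p (x p)))‖
        ≤ ∑ q, ‖h x / n - g q (∑ p, ψ q p (x p))‖ := norm_sum_le _ _
      _ ≤ ∑ q : Fin n, (η / n + if q ∈ bad then 2 * ‖h‖ / n else 0) :=
          Finset.sum_le_sum fun q _ => e2 q
      _ = η + bad.card * (2 * ‖h‖ / n) := by
          rw [Finset.sum_add_distrib, Finset.sum_ite_mem]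
          simp
          field_simp
      _ ≤ η + m * (2 * ‖h‖ / n) := by gcongr
      _ < (2*m+1/2)/(2*m+1) * ‖h‖ := by
          rw [hη, ← hnR]
          have : ‖h‖ / (4 * n) + m * (2 * ‖h‖ / n) = (2 * m + 1/4) / n * ‖h‖ := by
            field_simp; ring
          rw [this]
          gcongr
          norm_num

open unitInterval in
lemma exists_psi (m : ℕ) : ∃ ψ : Fin m → Fin (2*m+1) → C(I, ℝ), ∃ θ : ℝ, 0 ≤ θ ∧ θ < 1 ∧
    ∀ h : C(Fin m → I, ℝ), ∃ g : Fin (2*m+1) → BoundedContinuousFunction ℝ ℝ,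
      (∀ q, ‖g q‖ ≤ 2 * ‖h‖) ∧ ‖h - superT ψ g‖ ≤ θ * ‖h‖ := by
  set θ : ℝ := (2*m+1/2)/(2*m+1) with hθ
  have hθ0 : 0 ≤ θ := by positivity
  have hθ1 : θ < 1 := by
    rw [hθ, div_lt_one (by positivity)]; norm_num
  let d := TopologicalSpace.denseSeq C(Fin m → I, ℝ)
  have : BaireSpace (Fin m → Fin (2*m+1) → C(I, ℝ)) :=
    BaireSpace.of_completelyPseudoMetrizable
  have hd : Dense (⋂ k : {k : ℕ // d k ≠ 0}, goodSet m (2*m+1) θ (d k)) :=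
    dense_iInter_of_isOpen (fun k => goodSet_open _ _ _ _) (fun k => goodSet_dense m _ k.2)
  obtain ⟨ψ, hψ⟩ := hd.nonempty
  rw [Set.mem_iInter] at hψ
  refine ⟨ψ, (1 + θ) / 2, by linarith, by linarith, ?_⟩
  intro h
  by_cases hh : h = 0
  · refine ⟨0, ?_, ?_⟩
    · intro q; simp [hh]
    · have : superT ψ 0 = 0 := by ext x; simp [superT_apply]
      rw [this, hh]; simp
  have hn : 0 < ‖h‖ := norm_pos_iff.2 hh
  obtain ⟨k, hk⟩ := (TopologicalSpace.denseRange_denseSeq C(Fin m → I, ℝ)).exists_dist_lt h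
    (ε := (1 - θ) / 4 * ‖h‖) (by apply mul_pos <;> linarith)
  change dist h (d k) < _ at hk
  rw [dist_eq_norm] at hk
  have hle : (1 - θ) / 4 * ‖h‖ ≤ 1/4 * ‖h‖ := by gcongr; linarith
  have hk0 : d k ≠ 0 := by
    intro h0
    rw [h0, sub_zero] at hk
    linarith
  obtain ⟨g, hg, hg2⟩ := hψ ⟨k, hk0⟩
  have hdk : ‖d k‖ ≤ ‖h‖ + (1 - θ) / 4 * ‖h‖ := by
    have := norm_sub_norm_le (d k) h
    rw [norm_sub_rev] at this
    linarith
  refine ⟨g, fun q => (hg q).trans ?_, ?_⟩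
  · change ‖d k‖ ≤ _
    linarith
  · have h1 : ‖h - superT ψ g‖ ≤ ‖h - d k‖ + ‖d k - superT ψ g‖ := norm_sub_le_norm_sub_add_norm_sub _ _ _
    change ‖d k - superT ψ g‖ < θ * ‖d k‖ at hg2
    have h2 : θ * ‖d k‖ ≤ θ * (‖h‖ + (1 - θ) / 4 * ‖h‖) := by gcongr
    have h3 : (1 - θ) / 4 * ‖h‖ + θ * (‖h‖ + (1 - θ) / 4 * ‖h‖) ≤ (1 + θ) / 2 * ‖h‖ := by
      have : (1 - θ) / 4 + θ * (1 + (1 - θ) / 4) ≤ (1 + θ) / 2 := by nlinarith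
      nlinarith
    linarith

open unitInterval in
lemma exists_exact (m : ℕ) : ∃ ψ : Fin m → Fin (2*m+1) → C(I, ℝ),
    ∀ h : C(Fin m → I, ℝ), ∃ g : Fin (2*m+1) → BoundedContinuousFunction ℝ ℝ,
      ∀ x, h x = ∑ q, g q (∑ p, ψ p q (x p)) := by
  obtain ⟨ψ, θ, hθ0, hθ1, H⟩ := exists_psi m
  refine ⟨ψ, fun h => ?_⟩
  choose G hG1 hG2 using H
  let r : ℕ → C(Fin m → I, ℝ) := fun k => (fun f => f - superT ψ (G f))^[k] h
  have hr : ∀ k, r (k+1) = r k - superT ψ (G (r k)) := by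
    intro k
    simp only [r, Function.iterate_succ_apply']
  have hrn : ∀ k, ‖r k‖ ≤ θ ^ k * ‖h‖ := by
    intro k
    induction k with
    | zero => simp [r]
    | succ k ih =>
      rw [hr, pow_succ']
      refine (hG2 _).trans ?_
      rw [mul_assoc]
      gcongr
  have hsum : ∀ q, Summable (fun k => G (r k) q) := by
    intro q
    refine Summable.of_norm_bounded (g := fun k => 2 * ‖h‖ * θ ^ k)
      ((summable_geometric_of_lt_one hθ0 hθ1).mul_left _) ?_
    intro k
    refine (hG1 _ q).trans ?_
    have := hrn k
    nlinarith
  refine ⟨fun q => ∑' k, G (r k) q, fun x => ?_⟩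
  have h1 : ∀ q, HasSum (fun k => G (r k) q (∑ p, ψ p q (x p)))
      ((∑' k, G (r k) q) (∑ p, ψ p q (x p))) := by
    intro q
    exact (hsum q).hasSum.mapL (BoundedContinuousFunction.evalCLM ℝ (∑ p, ψ p q (x p)))
  have h2 := (hasSum_sum (s := Finset.univ) (fun q _ => h1 q)).tendsto_sum_nat
  have h3 : ∀ K, ∑ k ∈ Finset.range K, ∑ q, G (r k) q (∑ p, ψ p q (x p)) = h x - r K x := by
    intro K
    induction K with
    | zero => simp [r]
    | succ K ih =>
      rw [Finset.sum_range_succ, ih, hr, ContinuousMap.sub_apply, superT_apply]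
      ring
  have h4 : Filter.Tendsto (fun K => r K x) Filter.atTop (nhds 0) := by
    apply squeeze_zero_norm (a := fun k => θ ^ k * ‖h‖)
    · intro k
      exact ((r k).norm_coe_le_norm x).trans (hrn k)
    · simpa using (tendsto_pow_atTop_nhds_zero_of_lt_one hθ0 hθ1).mul_const ‖h‖
  have h5 : Filter.Tendsto (fun K => h x - r K x) Filter.atTop (nhds (h x)) := by
    simpa using tendsto_const_nhds.sub h4
  simp only [h3] at h2
  exact tendsto_nhds_unique h5 h2

/-- Embedding of the line in the unit interval. -/
noncomputable def lineEmb (t : ℝ) : unitInterval :=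
  ⟨(1 + t / (1 + |t|)) / 2, by
    have h0 : 0 < 1 + |t| := by positivity
    have h1 : |t / (1 + |t|)| ≤ 1 := by
      rw [abs_div, abs_of_pos h0, div_le_one h0]; linarith
    rw [abs_le] at h1
    constructor <;> linarith⟩

lemma lineEmb_cont : Continuous lineEmb := by
  unfold lineEmb
  refine Continuous.subtype_mk ?_ _
  have : ∀ t : ℝ, 1 + |t| ≠ 0 := fun t => by positivity
  fun_prop (disch := assumption)

/-- Truncated inverse of `lineEmb`. -/
noncomputable def lineInv (R : ℝ) (y : unitInterval) : ℝ :=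
  (2 * (y:ℝ) - 1) / max (1 - |2 * (y:ℝ) - 1|) (1 / (1 + R))

lemma lineInv_cont (R : ℝ) (hR : 0 < R) : Continuous (lineInv R) := by
  unfold lineInv
  refine Continuous.div (by fun_prop) (by fun_prop) ?_
  intro y
  have : 0 < 1 / (1 + R) := by positivity
  exact (lt_of_lt_of_le this (le_max_right _ _)).ne'

lemma lineInv_lineEmb (R : ℝ) (hR : 0 < R) (t : ℝ) :
    lineInv R (lineEmb t) = t / (1 + |t|) / max (1 / (1 + |t|)) (1 / (1 + R)) := by
  have e : 2 * ((lineEmb t : unitInterval) : ℝ) - 1 = t / (1 + |t|) := by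
    simp only [lineEmb]; ring
  have h0 : 0 < 1 + |t| := by positivity
  have e2 : 1 - |t / (1 + |t|)| = 1 / (1 + |t|) := by
    rw [abs_div, abs_of_pos h0]; field_simp; ring
  unfold lineInv
  rw [e, e2]

lemma lineInv_small (R : ℝ) (hR : 0 < R) (t : ℝ) (ht : |t| ≤ R) : lineInv R (lineEmb t) = t := by
  have h0 : 0 < 1 + |t| := by positivity
  rw [lineInv_lineEmb R hR, max_eq_left (by gcongr)]
  field_simp

lemma lineInv_large (R : ℝ) (hR : 0 < R) (t : ℝ) (ht : R ≤ |t|) : R ≤ |lineInv R (lineEmb t)| := by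
  have h0 : 0 < 1 + |t| := by positivity
  rw [lineInv_lineEmb R hR, max_eq_right (by gcongr), abs_div, abs_div, abs_of_pos h0,
    abs_of_pos (a := 1 / (1 + R)) (by positivity)]
  rw [div_div_eq_mul_div, div_one, div_mul_eq_mul_div, le_div_iff₀ h0]
  nlinarith

/-- Superposition for compactly supported functions: there are continuous
`ψ p q : ℝ → ℝ` such that every compactly supported continuous
`h : ℝ^m → ℝ` can be written `h x = ∑ q, g q (∑ p, ψ p q (x p))` where each
`g q : ℝ → ℝ` is continuous and compactly supported. -/
theorem superposition_compact_support (m : ℕ) (hm : 1 ≤ m) :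
    ∃ ψ : Fin m → Fin (2 * m + 1) → ℝ → ℝ,
      (∀ p q, Continuous (ψ p q)) ∧
      ∀ h : (Fin m → ℝ) → ℝ, Continuous h → HasCompactSupport h →
        ∃ g : Fin (2 * m + 1) → ℝ → ℝ,
          (∀ q, Continuous (g q)) ∧
          (∀ q, HasCompactSupport (g q)) ∧
          ∀ x : Fin m → ℝ,
            h x = ∑ q : Fin (2 * m + 1), g q (∑ p : Fin m, ψ p q (x p)) := by
  obtain ⟨ψ, hψ⟩ := exists_exact m
  refine ⟨fun p q t => ψ p q (lineEmb t), fun p q => (ψ p q).continuous.comp lineEmb_cont, ?_⟩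
  intro h hc hs
  obtain ⟨R₀, hR₀⟩ := hs.isCompact.isBounded.exists_norm_le
  set R : ℝ := |R₀| + 1 with hRdef
  have hR : 0 < R := by positivity
  have hz : ∀ x : Fin m → ℝ, (∃ p, R ≤ |x p|) → h x = 0 := by
    rintro x ⟨p, hp⟩
    by_contra hne
    have h1 := hR₀ x (subset_tsupport h hne)
    have h2 := norm_le_pi_norm x p
    rw [Real.norm_eq_abs] at h2
    have := le_abs_self R₀
    linarith
  let H : C(Fin m → unitInterval, ℝ) := ⟨fun y => h (fun p => lineInv R (y p)), by
    refine hc.comp (continuous_pi fun p => (lineInv_cont R hR).comp (continuous_apply p))⟩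
  have hH : ∀ x : Fin m → ℝ, h x = H (fun p => lineEmb (x p)) := by
    intro x
    change h x = h (fun p => lineInv R (lineEmb (x p)))
    by_cases hx : ∃ p, R ≤ |x p|
    · obtain ⟨p, hp⟩ := hx
      rw [hz x ⟨p, hp⟩, hz _ ⟨p, lineInv_large R hR _ hp⟩]
    · push Not at hx
      congr 1
      funext p
      rw [lineInv_small R hR _ (hx p).le]
  obtain ⟨g, hg⟩ := hψ H
  let B : Fin (2*m+1) → ℝ := fun q => ‖innerPhi ψ q‖
  refine ⟨fun q y => g q y * max 0 (min 1 (B q + 1 - |y|)), ?_, ?_, ?_⟩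
  · intro q
    have := (g q).continuous
    fun_prop
  · intro q
    refine HasCompactSupport.intro (K := Set.Icc (-(B q + 1)) (B q + 1)) isCompact_Icc ?_
    intro y hy
    have : B q + 1 < |y| := by
      by_contra hcon
      push Not at hcon
      exact hy (abs_le.1 hcon)
    simp only
    rw [max_eq_left, mul_zero]
    exact (min_le_right _ _).trans (by linarith)
  · intro x
    rw [hH, hg]
    refine Finset.sum_congr rfl fun q _ => ?_
    have hb := (innerPhi ψ q).norm_coe_le_norm (fun p => lineEmb (x p))
    rw [innerPhi_apply, Real.norm_eq_abs] at hb
    simp only [B]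
    rw [min_eq_left (by linarith), max_eq_right zero_le_one, mul_one]
end
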